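/- arXiv:math/0210369 — 3 statements merged into one kernel-verified Lean document; each statement's English description precedes it below -/
import Mathlib

section
/- Let n ≥ 1, let U ⊆ ℂ be open, and let f : U → ℂⁿ be a Lebesgue measurable map. Suppose that for almost every z₀ ∈ U there exists a neighborhood B ⊆ U of z₀ such that for every γ > 0, Σ_{t} |{z ∈ B : δ(g_t u_{f(z)} Λ) ≤ e^{−γσ(t)}}| < ∞, where the sum ranges over all t ∈ ℤⁿ with nonnegative components, |·| denotes Lebesgue measure on ℂ ≅ ℝ², and δ is taken with respect to the sup norm on ℝ^{n+2}. Then f is strongly extremal: for Lebesgue-almost every z ∈ U, ω^×(f(z)) = (n−1)/2. -/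
open MeasureTheory

noncomputable def omegaMul (n : ℕ) (z : Fin n → ℂ) : ENNReal :=
  sSup (ENNReal.ofReal '' {v : ℝ | 0 < v ∧
    {pq : (Fin n → ℤ) × ℤ |
      ‖(∑ i, z i * (pq.1 i : ℂ)) + (pq.2 : ℂ)‖ ≤
        (∏ i, max |(pq.1 i : ℝ)| 1) ^ (-(v / (n : ℝ)))}.Infinite})

noncomputable def lamVec (n : ℕ) (p : ℤ) (q : Fin n → ℤ) : Fin (n + 2) → ℝ :=
  Fin.cons (p : ℝ) (Fin.cons 0 fun i => (q i : ℝ))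

/-- The subgroup Λ = {(p, 0, q₁, …, qₙ)} of ℝ^{n+2}, as a set. -/
def LambdaSet (n : ℕ) : Set (Fin (n + 2) → ℝ) :=
  {w | ∃ (p : ℤ) (q : Fin n → ℤ), w = lamVec n p q}

/-- The action of the matrix u_z on ℝ^{n+2}. -/
noncomputable def uApply (n : ℕ) (z : Fin n → ℂ) (w : Fin (n + 2) → ℝ) : Fin (n + 2) → ℝ :=
  w + Fin.cons (∑ i, (z i).re * w i.succ.succ)
        (Fin.cons (∑ i, (z i).im * w i.succ.succ) 0)

/-- The action of the diagonal matrix g_t on ℝ^{n+2}. -/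
noncomputable def gApply (n : ℕ) (t : Fin n → ℝ) (w : Fin (n + 2) → ℝ) : Fin (n + 2) → ℝ :=
  fun j =>
    (Fin.cons (Real.exp ((((n : ℝ) - 1) / (2 * n)) * ∑ i, t i))
      (Fin.cons (Real.exp ((((n : ℝ) - 1) / (2 * n)) * ∑ i, t i))
        fun i => Real.exp (-t i)) : Fin (n + 2) → ℝ) j * w j

/-- δ(S): the infimum of sup-norms of nonzero elements of S. -/
noncomputable def deltaSup (m : ℕ) (S : Set (Fin m → ℝ)) : ℝ :=
  sInf {r : ℝ | ∃ v ∈ S, v ≠ 0 ∧ ‖v‖ = r}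

lemma aux_one_le {ι : Type*} (s : Finset ι) (x : ι → ℝ) (hx : ∀ i, 1 ≤ x i) :
    (1:ℝ) ≤ ∏ i ∈ s, x i := by
  have := Finset.prod_le_prod (s := s) (f := fun _ => (1:ℝ)) (g := x)
    (fun i _ => zero_le_one) (fun i _ => hx i)
  simpa using this

lemma aux_prod_ge_one (n : ℕ) (q : Fin n → ℤ) : (1:ℝ) ≤ ∏ i, max |(q i : ℝ)| 1 :=
  aux_one_le _ _ (fun i => le_max_right _ _)

lemma aux_le_prod (n : ℕ) (q : Fin n → ℤ) (j : Fin n) :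
    |(q j : ℝ)| ≤ ∏ i, max |(q i : ℝ)| 1 := by
  have h1 : max |(q j : ℝ)| 1 ≤ ∏ i, max |(q i : ℝ)| 1 := by
    rw [← Finset.mul_prod_erase Finset.univ _ (Finset.mem_univ j)]
    have : (1:ℝ) ≤ ∏ i ∈ Finset.univ.erase j, max |(q i : ℝ)| 1 :=
      aux_one_le _ _ (fun i => le_max_right _ _)
    have h0 : (0:ℝ) ≤ max |(q j : ℝ)| 1 := le_trans zero_le_one (le_max_right _ _)
    nlinarith
  exact le_trans (le_max_left _ _) h1

lemma aux_norm_sum (n : ℕ) (z : Fin n → ℂ) (q : Fin n → ℤ) (K : ℝ)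
    (hK : ∀ i, |(q i : ℝ)| ≤ K) :
    ‖∑ i, z i * (q i : ℂ)‖ ≤ (∑ i, ‖z i‖) * K := by
  rw [Finset.sum_mul]
  refine (norm_sum_le _ _).trans (Finset.sum_le_sum fun i _ => ?_)
  rw [norm_mul, Complex.norm_intCast]
  exact mul_le_mul_of_nonneg_left (hK i) (norm_nonneg _)

/-- Pairs with bounded height form a finite set. -/
lemma aux_finite (n : ℕ) (z : Fin n → ℂ) (M : ℝ) :
    {pq : (Fin n → ℤ) × ℤ | ‖(∑ i, z i * (pq.1 i : ℂ)) + (pq.2 : ℂ)‖ ≤ 1 ∧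
      (∏ i, max |(pq.1 i : ℝ)| 1) ≤ M}.Finite := by
  set K' : ℝ := (∑ i, ‖z i‖) * M + 1 with hK'
  refine ((Set.finite_Icc (fun _ : Fin n => -⌈M⌉) (fun _ : Fin n => ⌈M⌉)).prod
    (Set.finite_Icc (-⌈K'⌉) ⌈K'⌉)).subset ?_
  rintro ⟨q, p⟩ ⟨h1, h2⟩
  simp only at h1 h2
  have hq : ∀ i, |(q i : ℝ)| ≤ M := fun i => (aux_le_prod n q i).trans h2
  have hp : |(p : ℝ)| ≤ K' := by
    have h3 := aux_norm_sum n z q M hq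
    have : (p : ℂ) = ((∑ i, z i * (q i : ℂ)) + (p : ℂ)) - ∑ i, z i * (q i : ℂ) := by ring
    rw [← Complex.norm_intCast, this]
    refine (norm_sub_le _ _).trans ?_
    linarith
  have key : ∀ (a : ℤ) (R : ℝ), |(a : ℝ)| ≤ R → -⌈R⌉ ≤ a ∧ a ≤ ⌈R⌉ := by
    intro a R h
    have h4 := h.trans (Int.le_ceil R)
    have : |a| ≤ ⌈R⌉ := by exact_mod_cast h4
    exact abs_le.mp this
  exact ⟨⟨fun i => (key _ _ (hq i)).1, fun i => (key _ _ (hq i)).2⟩, key _ _ hp⟩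

lemma aux_delta (n : ℕ) (z : Fin n → ℂ) (t : Fin n → ℝ) (q : Fin n → ℤ) (p : ℤ) (r : ℝ)
    (hq : ∃ i, q i ≠ 0)
    (h1 : Real.exp ((((n : ℝ) - 1) / (2 * n)) * ∑ i, t i) *
      ‖(∑ i, z i * (q i : ℂ)) + (p : ℂ)‖ ≤ r)
    (h2 : ∀ i, Real.exp (-t i) * |(q i : ℝ)| ≤ r) :
    deltaSup (n + 2) ((fun w => gApply n t (uApply n z w)) '' LambdaSet n) ≤ r := by
  have hr : 0 ≤ r := le_trans (by positivity) h1
  set w := gApply n t (uApply n z (lamVec n p q)) with hw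
  have hre : ((∑ i, z i * (q i : ℂ)) + (p : ℂ)).re = p + ∑ i, (z i).re * (q i : ℝ) := by
    simp [Complex.add_re, Complex.re_sum, Complex.mul_re, add_comm]
  have him : ((∑ i, z i * (q i : ℂ)) + (p : ℂ)).im = ∑ i, (z i).im * (q i : ℝ) := by
    simp [Complex.add_im, Complex.im_sum, Complex.mul_im]
  have w0 : w 0 = Real.exp ((((n : ℝ) - 1) / (2 * n)) * ∑ i, t i) *
      ((∑ i, z i * (q i : ℂ)) + (p : ℂ)).re := by
    rw [hre]; simp [hw, gApply, uApply, lamVec]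
  have w1 : w 1 = Real.exp ((((n : ℝ) - 1) / (2 * n)) * ∑ i, t i) *
      ((∑ i, z i * (q i : ℂ)) + (p : ℂ)).im := by
    rw [him]
    have : (1 : Fin (n+2)) = Fin.succ 0 := rfl
    rw [this]
    simp only [hw, gApply, uApply, lamVec, Pi.add_apply, Fin.cons_succ, Fin.cons_zero, zero_add]
  have w2 : ∀ i : Fin n, w i.succ.succ = Real.exp (-t i) * (q i : ℝ) := by
    intro i; simp [hw, gApply, uApply, lamVec]
  have hwle : ‖w‖ ≤ r := by
    rw [pi_norm_le_iff_of_nonneg hr]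
    intro j
    refine Fin.cases ?_ (fun j => Fin.cases ?_ (fun i => ?_) j) j
    · rw [w0, Real.norm_eq_abs, abs_mul, abs_of_pos (Real.exp_pos _)]
      exact (mul_le_mul_of_nonneg_left (Complex.abs_re_le_norm _) (Real.exp_pos _).le).trans h1
    · change ‖w 1‖ ≤ r
      rw [w1, Real.norm_eq_abs, abs_mul, abs_of_pos (Real.exp_pos _)]
      exact (mul_le_mul_of_nonneg_left (Complex.abs_im_le_norm _) (Real.exp_pos _).le).trans h1
    · rw [w2, Real.norm_eq_abs, abs_mul, abs_of_pos (Real.exp_pos _)]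
      exact h2 i
  have hwne : w ≠ 0 := by
    obtain ⟨i, hi⟩ := hq
    intro h0
    have := w2 i
    rw [h0] at this
    have h3 : Real.exp (-t i) * (q i : ℝ) ≠ 0 :=
      mul_ne_zero (Real.exp_pos _).ne' (by exact_mod_cast hi)
    exact h3 this.symm
  refine le_trans (csInf_le ⟨0, ?_⟩ ⟨w, ⟨lamVec n p q, ⟨p, q, rfl⟩, rfl⟩, hwne, rfl⟩) hwle
  rintro _ ⟨v, _, _, rfl⟩
  exact norm_nonneg _

lemma aux_upper (n : ℕ) (hn : 1 ≤ n) (z : Fin n → ℂ) (v : ℝ) (hv : ((n : ℝ) - 1) / 2 < v)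
    (hfin : ∀ k : ℕ, {t : {t : Fin n → ℤ // ∀ i, 0 ≤ t i} | deltaSup (n + 2)
            ((fun w => gApply n (fun i => ((t : Fin n → ℤ) i : ℝ)) (uApply n z w)) ''
              LambdaSet n) ≤ Real.exp (-(1 / ((k : ℝ) + 1)) *
                ∑ i, ((t : Fin n → ℤ) i : ℝ))}.Finite) :
    {pq : (Fin n → ℤ) × ℤ |
      ‖(∑ i, z i * (pq.1 i : ℂ)) + (pq.2 : ℂ)‖ ≤
        (∏ i, max |(pq.1 i : ℝ)| 1) ^ (-(v / (n : ℝ)))}.Finite := by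
  have hn' : (1:ℝ) ≤ n := by exact_mod_cast hn
  have hn0 : (0:ℝ) < n := by linarith
  set a : ℝ := ((n : ℝ) - 1) / (2 * n) with ha
  have ha2 : 2 * n * a = n - 1 := by rw [ha]; field_simp
  have ha0 : 0 ≤ a := by rw [ha]; apply div_nonneg <;> linarith
  set e : ℝ := v / n - a with he
  have he0 : 0 < e := by
    rw [he, ha, sub_pos, div_lt_div_iff₀ (by positivity) hn0]; nlinarith
  set g : ℝ := e / n with hg
  have hg0 : 0 < g := by positivity
  have hgn : n * g = e := by rw [hg]; field_simp
  obtain ⟨k, hk⟩ := exists_nat_one_div_lt (show 0 < g / (1 + 2 * n * g) by positivity)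
  set γ : ℝ := 1 / ((k : ℝ) + 1) with hγ
  have hγ0 : 0 < γ := by positivity
  have hγg : γ * (1 + 2 * n * g) ≤ g := by
    rw [lt_div_iff₀ (by positivity)] at hk; exact hk.le
  obtain ⟨M, hM⟩ := ((hfin k).image
    (fun t : {t : Fin n → ℤ // ∀ i, 0 ≤ t i} => ∑ i, ((t : Fin n → ℤ) i : ℝ))).bddAbove
  refine (aux_finite n z (Real.exp (max M (1 / g)))).subset ?_
  rintro ⟨q, p⟩ hqp
  simp only [Set.mem_ofPred_eq] at hqp ⊢
  have hP1 := aux_prod_ge_one n q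
  set P : ℝ := ∏ i, max |(q i : ℝ)| 1 with hP
  have hP0 : 0 < P := by linarith
  have hv0 : 0 < v := lt_of_le_of_lt (by apply div_nonneg <;> linarith) hv
  refine ⟨hqp.trans (Real.rpow_le_one_of_one_le_of_nonpos hP1 (by
    rw [neg_nonpos]; positivity)), ?_⟩
  rw [← Real.log_le_iff_le_exp hP0]
  set S := Real.log P with hS
  by_contra hcon
  push Not at hcon
  have hS1 : 1 / g < S := lt_of_le_of_lt (le_max_right _ _) hcon
  have hSM : M < S := lt_of_le_of_lt (le_max_left _ _) hcon
  have hS0 : 0 < S := lt_trans (by positivity) hS1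
  have hgS : 1 ≤ g * S := by
    rw [div_lt_iff₀ hg0] at hS1; linarith
  have hmax : ∀ i, 0 < max |(q i : ℝ)| 1 := fun i => lt_of_lt_of_le one_pos (le_max_right _ _)
  have hSsum : S = ∑ i, Real.log (max |(q i : ℝ)| 1) := by
    rw [hS, hP, Real.log_prod (fun i _ => (hmax i).ne')]
  have hlog0 : ∀ i, 0 ≤ Real.log (max |(q i : ℝ)| 1) := fun i =>
    Real.log_nonneg (le_max_right _ _)
  have hq : ∃ i, q i ≠ 0 := by
    by_contra hq
    push Not at hq
    rw [hSsum] at hS0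
    simp [hq] at hS0
  set t : Fin n → ℤ := fun i => ⌈Real.log (max |(q i : ℝ)| 1) + g * S⌉ with ht
  have ht_ge : ∀ i, Real.log (max |(q i : ℝ)| 1) + g * S ≤ t i := fun i => Int.le_ceil _
  have ht_le : ∀ i, (t i : ℝ) ≤ Real.log (max |(q i : ℝ)| 1) + g * S + 1 :=
    fun i => (Int.ceil_lt_add_one _).le
  have ht0 : ∀ i, 0 ≤ t i := fun i => Int.ceil_nonneg (by have := hlog0 i; positivity)
  set s : ℝ := ∑ i, (t i : ℝ) with hs
  have hs_ge : S ≤ s := by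
    rw [hSsum]
    refine Finset.sum_le_sum fun i _ => ?_
    have := ht_ge i
    linarith
  have hs_le : s ≤ (1 + 2 * n * g) * S := by
    have h1 : s ≤ ∑ i, (Real.log (max |(q i : ℝ)| 1) + g * S + 1) :=
      Finset.sum_le_sum fun i _ => ht_le i
    rw [Finset.sum_add_distrib, Finset.sum_add_distrib, ← hSsum] at h1
    simp only [Finset.sum_const, Finset.card_univ, Fintype.card_fin, nsmul_eq_mul, mul_one] at h1
    nlinarith
  have hγs : γ * s ≤ g * S := by
    calc γ * s ≤ γ * ((1 + 2 * n * g) * S) := mul_le_mul_of_nonneg_left hs_le hγ0.le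
      _ = (γ * (1 + 2 * n * g)) * S := by ring
      _ ≤ g * S := mul_le_mul_of_nonneg_right hγg hS0.le
  have has : a * s + γ * s ≤ v / n * S := by
    have h1 : a * s ≤ a * ((1 + 2 * n * g) * S) := mul_le_mul_of_nonneg_left hs_le ha0
    have h2 : a * ((1 + 2 * n * g) * S) = a * S + (n - 1) * g * S := by
      rw [← ha2]; ring
    have h3 : v / n * S = a * S + n * g * S := by rw [hgn, he]; ring
    nlinarith
  have hmem : deltaSup (n + 2)
      ((fun w => gApply n (fun i => (t i : ℝ)) (uApply n z w)) '' LambdaSet n) ≤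
        Real.exp (-γ * s) := by
    apply aux_delta n z _ q p _ hq
    · rw [← ha, ← hs]
      calc Real.exp (a * s) * ‖(∑ i, z i * (q i : ℂ)) + (p : ℂ)‖
          ≤ Real.exp (a * s) * P ^ (-(v / (n : ℝ))) :=
            mul_le_mul_of_nonneg_left hqp (Real.exp_pos _).le
        _ = Real.exp (a * s + S * (-(v / n))) := by
            rw [Real.rpow_def_of_pos hP0, Real.exp_add]
        _ ≤ Real.exp (-γ * s) := by
            apply Real.exp_le_exp.mpr; nlinarith
    · intro i
      calc Real.exp (-(t i : ℝ)) * |(q i : ℝ)|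
          ≤ Real.exp (-(t i : ℝ)) * max |(q i : ℝ)| 1 :=
            mul_le_mul_of_nonneg_left (le_max_left _ _) (Real.exp_pos _).le
        _ = Real.exp (-(t i : ℝ) + Real.log (max |(q i : ℝ)| 1)) := by
            rw [Real.exp_add, Real.exp_log (hmax i)]
        _ ≤ Real.exp (-γ * s) := by
            apply Real.exp_le_exp.mpr
            have := ht_ge i
            linarith
  have := hM ⟨⟨t, ht0⟩, hmem, rfl⟩
  simp only at this
  linarith

/-- Dirichlet's pigeonhole argument. -/
lemma aux_dirichlet (n : ℕ) (z : Fin n → ℂ) (N k C : ℕ) (hN : 1 ≤ N) (hk : 1 ≤ k)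
    (hC : ∑ i, ‖z i‖ ≤ C) (hcard : k ^ 2 * N * (2 * C + 1) < (N + 1) ^ n) :
    ∃ (q : Fin n → ℤ) (p : ℤ), (∃ i, q i ≠ 0) ∧ (∀ i, |(q i : ℝ)| ≤ N) ∧
      ‖(∑ i, z i * (q i : ℂ)) + (p : ℂ)‖ ≤ 2 / k := by
  have hk0 : (0:ℝ) < k := by exact_mod_cast hk
  set L : (Fin n → Fin (N + 1)) → ℂ := fun q => ∑ i, z i * ((q i : ℕ) : ℂ) with hL
  let F : (Fin n → Fin (N + 1)) → ℤ × ℤ := fun q =>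
    (⌊(k : ℝ) * Int.fract (L q).re⌋, ⌊(k : ℝ) * (L q).im⌋)
  let T : Finset (ℤ × ℤ) := Finset.Ico (0:ℤ) k ×ˢ Finset.Icc (-(C * k * N : ℤ)) (C * k * N)
  have hF : ∀ q ∈ (Finset.univ : Finset (Fin n → Fin (N + 1))), F q ∈ T := by
    intro q _
    have hb : ‖L q‖ ≤ C * N := by
      have := aux_norm_sum n z (fun i => ((q i : ℕ) : ℤ)) N (by
        intro i
        have := Nat.lt_succ_iff.mp (q i).2
        simp only [Int.cast_natCast, Nat.abs_cast]
        exact_mod_cast this)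
      simp only [Int.cast_natCast] at this
      exact this.trans (mul_le_mul_of_nonneg_right hC (by positivity))
    have him := abs_le.mp ((Complex.abs_im_le_norm _).trans hb)
    simp only [F, T, Finset.mem_product, Finset.mem_Ico, Finset.mem_Icc]
    refine ⟨⟨Int.floor_nonneg.mpr (mul_nonneg hk0.le (Int.fract_nonneg _)), ?_⟩, ?_, ?_⟩
    · rw [Int.floor_lt]
      have := Int.fract_lt_one (L q).re
      push_cast
      nlinarith
    · rw [Int.le_floor]; push_cast; nlinarith
    · have : (⌊(k : ℝ) * (L q).im⌋ : ℝ) ≤ C * k * N := by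
        refine (Int.floor_le _).trans ?_; nlinarith
      exact_mod_cast this
  have hTc : T.card < (Finset.univ : Finset (Fin n → Fin (N + 1))).card := by
    have h1 : T.card = k * (2 * (C * k * N) + 1) := by
      simp only [T, Finset.card_product, Int.card_Ico, Int.card_Icc]
      have h0 : ((k : ℤ) - 0).toNat = k := by simp
      rw [h0]
      congr 1
      · have : (C * k * N : ℤ) + 1 - -(C * k * N : ℤ) = ((2 * (C * k * N) + 1 : ℕ) : ℤ) := by
          push_cast; ring
        rw [this, Int.toNat_natCast]
    rw [h1]
    simp only [Finset.card_univ, Fintype.card_pi, Fintype.card_fin, Finset.prod_const]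
    refine lt_of_le_of_lt ?_ hcard
    have : 1 ≤ k * N := Nat.mul_pos hk hN
    nlinarith
  obtain ⟨q₁, _, q₂, _, hne, heq⟩ := Finset.exists_ne_map_eq_of_card_lt_of_maps_to hTc hF
  simp only [F, Prod.mk.injEq] at heq
  refine ⟨fun i => ((q₁ i : ℕ) : ℤ) - ((q₂ i : ℕ) : ℤ), ⌊(L q₂).re⌋ - ⌊(L q₁).re⌋, ?_, ?_, ?_⟩
  · by_contra hcon
    push Not at hcon
    apply hne
    funext i
    have := hcon i
    apply Fin.ext
    omega
  · intro i
    have h1 := (q₁ i).2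
    have h2 := (q₂ i).2
    have : |((q₁ i : ℕ) : ℤ) - ((q₂ i : ℕ) : ℤ)| ≤ N := by
      rw [abs_le]; omega
    exact_mod_cast this
  · have hsum : (∑ i, z i * (((((q₁ i : ℕ) : ℤ) - ((q₂ i : ℕ) : ℤ) : ℤ)) : ℂ)) = L q₁ - L q₂ := by
      rw [hL, ← Finset.sum_sub_distrib]
      refine Finset.sum_congr rfl fun i _ => ?_
      push_cast; ring
    rw [hsum]
    have e1 := Int.abs_sub_lt_one_of_floor_eq_floor heq.1
    have e2 := Int.abs_sub_lt_one_of_floor_eq_floor heq.2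
    rw [← mul_sub, abs_mul, abs_of_pos hk0] at e1 e2
    refine (Complex.norm_le_abs_re_add_abs_im _).trans ?_
    have r1 : (L q₁ - L q₂ + ((⌊(L q₂).re⌋ - ⌊(L q₁).re⌋ : ℤ) : ℂ)).re =
        Int.fract (L q₁).re - Int.fract (L q₂).re := by
      rw [Complex.add_re, Complex.sub_re, Complex.intCast_re]
      unfold Int.fract
      push_cast; ring
    have r2 : (L q₁ - L q₂ + ((⌊(L q₂).re⌋ - ⌊(L q₁).re⌋ : ℤ) : ℂ)).im =
        (L q₁).im - (L q₂).im := by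
      rw [Complex.add_im, Complex.sub_im, Complex.intCast_im, add_zero]
    rw [r1, r2, le_div_iff₀ hk0]
    nlinarith

lemma aux_lower (n : ℕ) (hn : 1 ≤ n) (z : Fin n → ℂ) (v : ℝ) (hv0 : 0 < v)
    (hv : v < ((n : ℝ) - 1) / 2) :
    {pq : (Fin n → ℤ) × ℤ |
      ‖(∑ i, z i * (pq.1 i : ℂ)) + (pq.2 : ℂ)‖ ≤
        (∏ i, max |(pq.1 i : ℝ)| 1) ^ (-(v / (n : ℝ)))}.Infinite := by
  have hn0 : (0:ℝ) < n := by exact_mod_cast hn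
  obtain ⟨C, hC⟩ := exists_nat_ge (∑ i, ‖z i‖)
  -- multiples of an exact relation
  by_cases hex : ∃ (q : Fin n → ℤ) (p : ℤ), (∃ i, q i ≠ 0) ∧
      (∑ i, z i * (q i : ℂ)) + (p : ℂ) = 0
  · obtain ⟨q, p, ⟨j, hj⟩, h0⟩ := hex
    refine Set.infinite_of_injective_forall_mem
      (f := fun m : ℕ => ((fun i => (m : ℤ) * q i, (m : ℤ) * p) : (Fin n → ℤ) × ℤ)) ?_ ?_
    · intro m m' hm
      have := congrFun (congrArg Prod.fst hm) j
      simp only at this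
      exact_mod_cast mul_right_cancel₀ hj this
    · intro m
      have : (∑ i, z i * (((m : ℤ) * q i : ℤ) : ℂ)) + (((m : ℤ) * p : ℤ) : ℂ) = 0 := by
        have h1 : (m : ℂ) * ((∑ i, z i * (q i : ℂ)) + (p : ℂ)) = 0 := by rw [h0, mul_zero]
        rw [← h1, mul_add, Finset.mul_sum]
        push_cast
        congr 1
        refine Finset.sum_congr rfl fun i _ => ?_
        ring
      simp only [Set.mem_ofPred_eq]
      rw [this, norm_zero]
      exact Real.rpow_nonneg (le_trans zero_le_one (aux_prod_ge_one n _)) _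
  push Not at hex
  intro hfin
  have htend : Filter.Tendsto (fun N : ℕ => (N : ℝ) ^ (-v)) Filter.atTop (nhds 0) :=
    (tendsto_rpow_neg_atTop hv0).comp tendsto_natCast_atTop_atTop
  have hev : ∀ᶠ N : ℕ in Filter.atTop, ∀ a ∈ {pq : (Fin n → ℤ) × ℤ |
      ‖(∑ i, z i * (pq.1 i : ℂ)) + (pq.2 : ℂ)‖ ≤
        (∏ i, max |(pq.1 i : ℝ)| 1) ^ (-(v / (n : ℝ)))}, (∃ i, a.1 i ≠ 0) →
        (N : ℝ) ^ (-v) < ‖(∑ i, z i * (a.1 i : ℂ)) + (a.2 : ℂ)‖ := by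
    rw [Filter.eventually_all_finite hfin]
    intro a _
    by_cases ha : ∃ i, a.1 i ≠ 0
    · have := hex a.1 a.2 ha
      filter_upwards [htend.eventually_lt_const (norm_pos_iff.mpr this)] with N hN _
      exact hN
    · exact Filter.Eventually.of_forall fun N h => absurd h ha
  have hbig : ∀ᶠ N : ℕ in Filter.atTop, (9 : ℝ) * (2 * C + 1) < (N : ℝ) ^ ((n : ℝ) - 1 - 2 * v) :=
    ((tendsto_rpow_atTop (show 0 < (n : ℝ) - 1 - 2 * v by linarith)).comp
      tendsto_natCast_atTop_atTop).eventually_gt_atTop _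
  obtain ⟨N, hN1, hN2, hN3⟩ := (hev.and (hbig.and (Filter.eventually_ge_atTop 1))).exists
  have hNr : (1:ℝ) ≤ N := by exact_mod_cast hN3
  have hN0 : (0:ℝ) < N := by linarith
  have hNv : (1:ℝ) ≤ (N : ℝ) ^ v := Real.one_le_rpow hNr hv0.le
  set k : ℕ := ⌈2 * (N : ℝ) ^ v⌉₊ with hk
  have hk1 : 2 * (N : ℝ) ^ v ≤ k := Nat.le_ceil _
  have hk2 : (k : ℝ) ≤ 3 * (N : ℝ) ^ v := by
    have := (Nat.ceil_lt_add_one (show 0 ≤ 2 * (N : ℝ) ^ v by positivity)).le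
    rw [← hk] at this
    linarith
  have hkpos : 1 ≤ k := by
    have : (1:ℝ) ≤ k := by linarith
    exact_mod_cast this
  have hcard : k ^ 2 * N * (2 * C + 1) < (N + 1) ^ n := by
    have h1 : (k : ℝ) ^ 2 * N * (2 * C + 1) < (N + 1 : ℝ) ^ n := by
      have h2 : (k : ℝ) ^ 2 ≤ 9 * (N : ℝ) ^ (2 * v) := by
        have h3 : (N : ℝ) ^ (2 * v) = ((N : ℝ) ^ v) ^ 2 := by
          rw [mul_comm, Real.rpow_mul hN0.le]; norm_num
        rw [h3]
        have : (k : ℝ) ^ 2 ≤ (3 * (N : ℝ) ^ v) ^ 2 := by gcongr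
        nlinarith
      calc (k : ℝ) ^ 2 * N * (2 * C + 1) ≤ 9 * (N : ℝ) ^ (2 * v) * N * (2 * C + 1) := by gcongr
        _ = (9 * (2 * C + 1)) * ((N : ℝ) ^ (2 * v) * N) := by ring
        _ < (N : ℝ) ^ ((n : ℝ) - 1 - 2 * v) * ((N : ℝ) ^ (2 * v) * N) := by
            apply mul_lt_mul_of_pos_right hN2; positivity
        _ = (N : ℝ) ^ n := by
            rw [← mul_assoc, ← Real.rpow_add hN0, ← Real.rpow_add_one hN0.ne',
              ← Real.rpow_natCast]
            congr 1; ring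
        _ ≤ (N + 1 : ℝ) ^ n := by gcongr; linarith
    exact_mod_cast h1
  obtain ⟨q, p, hq0, hqN, hqp⟩ := aux_dirichlet n z N k C hN3 hkpos hC hcard
  have hle : ‖(∑ i, z i * (q i : ℂ)) + (p : ℂ)‖ ≤ (N : ℝ) ^ (-v) := by
    refine hqp.trans ?_
    rw [Real.rpow_neg hN0.le, div_le_iff₀ (by linarith), ← div_eq_inv_mul,
      le_div_iff₀ (by linarith)]
    linarith
  have hP1 := aux_prod_ge_one n q
  have hPle : (∏ i, max |(q i : ℝ)| 1) ≤ (N : ℝ) ^ n := by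
    calc (∏ i, max |(q i : ℝ)| 1) ≤ ∏ _i : Fin n, (N : ℝ) :=
          Finset.prod_le_prod (fun i _ => le_trans zero_le_one (le_max_right _ _))
            (fun i _ => max_le (hqN i) hNr)
      _ = (N : ℝ) ^ n := by simp
  have hNP : (N : ℝ) ^ (-v) ≤ (∏ i, max |(q i : ℝ)| 1) ^ (-(v / (n : ℝ))) := by
    have h1 : (N : ℝ) ^ (-v) = ((N : ℝ) ^ n) ^ (-(v / (n : ℝ))) := by
      rw [← Real.rpow_natCast, ← Real.rpow_mul hN0.le]
      congr 1; field_simp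
    rw [h1]
    apply Real.rpow_le_rpow_of_nonpos (by linarith) hPle
    rw [neg_nonpos]; positivity
  have := hN1 (q, p) (hle.trans hNP) hq0
  simp only at this
  linarith

theorem corollary_two_four (n : ℕ) (hn : 1 ≤ n) (U : Set ℂ) (hUo : IsOpen U)
    (f : ℂ → (Fin n → ℂ)) (hf : Measurable f)
    (h : ∀ᵐ z₀ ∂(volume : Measure ℂ), z₀ ∈ U →
      ∃ B ∈ nhds z₀, B ⊆ U ∧ ∀ γ : ℝ, 0 < γ →
        (∑' t : {t : Fin n → ℤ // ∀ i, 0 ≤ t i},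
          volume {z ∈ B | deltaSup (n + 2)
            ((fun w => gApply n (fun i => ((t : Fin n → ℤ) i : ℝ)) (uApply n (f z) w)) ''
              LambdaSet n) ≤ Real.exp (-γ * ∑ i, ((t : Fin n → ℤ) i : ℝ))}) < ⊤) :
    ∀ᵐ z ∂(volume : Measure ℂ), z ∈ U →
      omegaMul n (f z) = ENNReal.ofReal (((n : ℝ) - 1) / 2) := by
  have hsub : ∀ᵐ z ∂(volume : Measure ℂ), z ∈ U → ∀ k : ℕ,
      {t : {t : Fin n → ℤ // ∀ i, 0 ≤ t i} | deltaSup (n + 2)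
            ((fun w => gApply n (fun i => ((t : Fin n → ℤ) i : ℝ)) (uApply n (f z) w)) ''
              LambdaSet n) ≤ Real.exp (-(1 / ((k : ℝ) + 1)) *
                ∑ i, ((t : Fin n → ℤ) i : ℝ))}.Finite := by
    have hnull : volume ({z₀ | z₀ ∈ U →
      ∃ B ∈ nhds z₀, B ⊆ U ∧ ∀ γ : ℝ, 0 < γ →
        (∑' t : {t : Fin n → ℤ // ∀ i, 0 ≤ t i},
          volume {z ∈ B | deltaSup (n + 2)
            ((fun w => gApply n (fun i => ((t : Fin n → ℤ) i : ℝ)) (uApply n (f z) w)) ''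
              LambdaSet n) ≤ Real.exp (-γ * ∑ i, ((t : Fin n → ℤ) i : ℝ))}) < ⊤} ∩
        {z | ¬ (z ∈ U → ∀ k : ℕ,
      {t : {t : Fin n → ℤ // ∀ i, 0 ≤ t i} | deltaSup (n + 2)
            ((fun w => gApply n (fun i => ((t : Fin n → ℤ) i : ℝ)) (uApply n (f z) w)) ''
              LambdaSet n) ≤ Real.exp (-(1 / ((k : ℝ) + 1)) *
                ∑ i, ((t : Fin n → ℤ) i : ℝ))}.Finite)}) = 0 := by
      refine measure_null_of_locally_null _ ?_
      rintro z₀ ⟨hz1, hz2⟩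
      have hzU : z₀ ∈ U := by
        by_contra hc
        exact hz2 fun hh => absurd hh hc
      obtain ⟨B, hB, hBU, hsum⟩ := hz1 hzU
      refine ⟨_, Filter.inter_mem self_mem_nhdsWithin (mem_nhdsWithin_of_mem_nhds hB), ?_⟩
      have hae : ∀ᵐ z ∂(volume : Measure ℂ), ∀ k : ℕ,
          {t : {t : Fin n → ℤ // ∀ i, 0 ≤ t i} | z ∈ {z ∈ B | deltaSup (n + 2)
            ((fun w => gApply n (fun i => ((t : Fin n → ℤ) i : ℝ)) (uApply n (f z) w)) ''
              LambdaSet n) ≤ Real.exp (-(1 / ((k : ℝ) + 1)) *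
                ∑ i, ((t : Fin n → ℤ) i : ℝ))}}.Finite := by
        rw [ae_all_iff]
        intro k
        exact ae_finite_setOfPred_mem (hsum (1 / ((k : ℝ) + 1)) (by positivity)).ne
      refine measure_mono_null ?_ hae
      rintro z ⟨⟨_, hz2⟩, hzB⟩ hcon
      apply hz2
      intro _ k
      exact (hcon k).subset fun t ht => ⟨hzB, ht⟩
    have hnull' : ∀ᵐ z ∂(volume : Measure ℂ), z ∉ _ := measure_eq_zero_iff_ae_notMem.mp hnull
    filter_upwards [h, hnull'] with z hz1 hz2
    by_contra hc
    exact hz2 ⟨hz1, hc⟩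
  filter_upwards [hsub] with z hz hzU
  have hn' : (1:ℝ) ≤ n := by exact_mod_cast hn
  apply le_antisymm
  · refine sSup_le ?_
    rintro _ ⟨v, ⟨hv0, hvinf⟩, rfl⟩
    apply ENNReal.ofReal_le_ofReal
    by_contra hc
    push Not at hc
    exact hvinf (aux_upper n hn (f z) v hc (hz hzU))
  · by_contra hc
    push Not at hc
    set s := omegaMul n (f z) with hs
    have hst : s ≠ ⊤ := ne_top_of_lt hc
    have h1 : s.toReal < ((n : ℝ) - 1) / 2 := (ENNReal.lt_ofReal_iff_toReal_lt hst).mp hc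
    have h0 : 0 ≤ s.toReal := ENNReal.toReal_nonneg
    set v := (s.toReal + ((n : ℝ) - 1) / 2) / 2 with hv
    have hle : ENNReal.ofReal v ≤ s := by
      rw [hs]
      exact le_sSup ⟨v, ⟨by linarith, aux_lower n hn (f z) v (by linarith) (by linarith)⟩, rfl⟩
    have := (ENNReal.ofReal_le_iff_le_toReal hst).mp hle
    linarith
end

section
/- Let n ≥ 1, let U ⊆ ℂ be open, and let f : U → ℂⁿ be a continuous map. Assume that for Lebesgue-almost every z₀ ∈ U there exist r₀ > 0 with B̃ = B(z₀, 3^{n+1} r₀) ⊆ U, and constants C, α, ρ > 0, such that for every t ∈ [0,∞)ⁿ and every nonzero subgroup Γ of Λ: (i) the function z ↦ ‖g_t u_{f(z)} Γ‖ is (C,α)-good on B̃ (identifying ℂ with ℝ²), and (ii) sup_{z ∈ B(z₀,r₀)} ‖g_t u_{f(z)} Γ‖ ≥ ρ. Then f is strongly extremal: for Lebesgue-almost every z ∈ U, ω^×(f(z)) = (n−1)/2. -/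
open MeasureTheory

/-- The covolume of the subgroup generated by the (linearly independent) family w:
the square root of the Gram determinant. -/
noncomputable def covol {m l : ℕ} (w : Fin l → (Fin m → ℝ)) : ℝ :=
  Real.sqrt (Matrix.det (Matrix.of fun i j => ∑ a, w i a * w j a))

/-- f is (C,α)-good on V ⊆ ℂ ≅ ℝ². -/
def IsGoodC (C α : ℝ) (V : Set ℂ) (f : ℂ → ℝ) : Prop :=
  ∀ (x : ℂ) (r : ℝ), Metric.ball x r ⊆ V → ∀ ε : ℝ, 0 < ε →
    volume {y ∈ Metric.ball x r | |f y| < ε * ⨆ w ∈ Metric.ball x r, |f w|} ≤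
      ENNReal.ofReal (C * ε ^ α) * volume (Metric.ball x r)


def GoodOn (C α : ℝ) (V : Set ℂ) (ψ : ℂ → ℝ) : Prop :=
  ∀ (x : ℂ) (r : ℝ), Metric.ball x r ⊆ V → ∀ ε : ℝ, 0 < ε → ∀ y₀ ∈ Metric.ball x r,
    volume {y ∈ Metric.ball x r | ψ y < ε * ψ y₀} ≤
      ENNReal.ofReal (C * ε ^ α) * volume (Metric.ball x r)

lemma vol_ball_scale (x y : ℂ) (r s : ℝ) (hs : 0 ≤ s) (hr : 0 ≤ r) :
    volume (Metric.ball x (s * r)) = ENNReal.ofReal (s ^ 2) * volume (Metric.ball y r) := by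
  rw [Complex.volume_ball, Complex.volume_ball, ENNReal.ofReal_mul hs, mul_pow,
    ENNReal.ofReal_pow hs, mul_assoc]

lemma vol_ball_pos (x : ℂ) (r : ℝ) (hr : 0 < r) : 0 < volume (Metric.ball x r) :=
  Metric.measure_ball_pos _ _ hr

lemma vol_ball_ne_top (x : ℂ) (r : ℝ) : volume (Metric.ball x r) ≠ ⊤ :=
  (measure_ball_lt_top).ne

lemma good_shrink {C α : ℝ} {V : Set ℂ} {ψ : ℂ → ℝ} (hg : GoodOn C α V ψ)
    {x : ℂ} {r s : ℝ} (hr : 0 < r) (hs : 0 ≤ s) (hC : 0 < C) (hsub : Metric.ball x (s * r) ⊆ V)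
    (hs1 : 1 ≤ s) {c : ℝ} (hc : 0 < c) (hcs : C * c ^ α * s ^ 2 < 1)
    {y₀ : ℂ} (hy : y₀ ∈ Metric.ball x (s * r)) :
    ∃ y ∈ Metric.ball x r, c * ψ y₀ ≤ ψ y := by
  by_contra hcon
  push Not at hcon
  have h1 := hg x (s * r) hsub c hc y₀ hy
  have h2 : Metric.ball x r ⊆ {y ∈ Metric.ball x (s * r) | ψ y < c * ψ y₀} := by
    intro y hy'
    refine ⟨Metric.ball_subset_ball (by nlinarith) hy', hcon y hy'⟩
  have h3 := (measure_mono h2).trans h1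
  rw [vol_ball_scale x x r s hs hr.le, ← mul_assoc, ← ENNReal.ofReal_mul (by positivity)] at h3
  have h4 : ENNReal.ofReal (C * c ^ α * s ^ 2) * volume (Metric.ball x r)
      < 1 * volume (Metric.ball x r) := by
    apply ENNReal.mul_lt_mul_left (vol_ball_pos x r hr).ne' (vol_ball_ne_top x r)
    simpa using hcs
  rw [one_mul] at h4
  exact absurd h3 (not_le.mpr h4)

lemma exists_shrink_const {C α : ℝ} (hC : 0 < C) (hα : 0 < α) {s : ℝ} (hs : 1 ≤ s) :
    ∃ c : ℝ, 0 < c ∧ c ≤ 1 ∧ C * c ^ α * s ^ 2 < 1 := by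
  have h0 : (0:ℝ) < 1 / (2 * C * s ^ 2) := by positivity
  refine ⟨min 1 ((1 / (2 * C * s ^ 2)) ^ (1 / α)), by positivity, min_le_left _ _, ?_⟩
  have h1 : (min 1 ((1 / (2 * C * s ^ 2)) ^ (1 / α))) ^ α ≤ 1 / (2 * C * s ^ 2) := by
    calc _ ≤ ((1 / (2 * C * s ^ 2)) ^ (1 / α)) ^ α :=
          Real.rpow_le_rpow (by positivity) (min_le_right _ _) hα.le
      _ = _ := by rw [← Real.rpow_mul h0.le]; simp [hα.ne']
  calc _ ≤ C * (1 / (2 * C * s ^ 2)) * s ^ 2 := by gcongr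
    _ = 1 / 2 := by field_simp
    _ < 1 := by norm_num

lemma besic_cover : ∃ N : ℕ, ∀ (S : Set ℂ) (r : ℂ → ℝ) (R : ℝ) (x₀ : ℂ) (κ : ENNReal),
    (∀ x ∈ S, 0 < r x ∧ r x ≤ R ∧ Metric.ball x (r x) ⊆ Metric.ball x₀ R ∧
      volume (S ∩ Metric.ball x (r x)) ≤ κ * volume (Metric.ball x (r x))) →
    volume S ≤ N * κ * volume (Metric.ball x₀ R) := by
  obtain ⟨N, τ, hτ, hN⟩ := HasBesicovitchCovering.no_satelliteConfig (α := ℂ)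
  refine ⟨N, fun S r R x₀ κ h => ?_⟩
  let q : Besicovitch.BallPackage S ℂ :=
    { c := fun x => x
      r := fun x => r x
      rpos := fun x => (h x x.2).1
      r_bound := R
      r_le := fun x => (h x x.2).2.1 }
  obtain ⟨s, hs1, hs2⟩ := Besicovitch.exist_disjoint_covering_families hτ hN q
  have hcount : ∀ i, (s i).Countable := by
    intro i
    refine (hs1 i).countable_of_nonempty_interior (fun j _ => ?_)
    refine ⟨j, ?_⟩
    exact Metric.ball_subset_interior_closedBall (Metric.mem_ball_self (h j j.2).1)
  have hcov : S ⊆ ⋃ i, ⋃ j ∈ s i, (S ∩ Metric.ball (j : ℂ) (r j)) := by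
    intro x hx
    have : x ∈ Set.range q.c := ⟨⟨x, hx⟩, rfl⟩
    have := hs2 this
    simp only [Set.mem_iUnion] at this ⊢
    obtain ⟨i, j, hj, hxj⟩ := this
    exact ⟨i, j, hj, hx, hxj⟩
  calc volume S ≤ volume (⋃ i, ⋃ j ∈ s i, (S ∩ Metric.ball (j : ℂ) (r j))) := measure_mono hcov
    _ ≤ ∑ i : Fin N, volume (⋃ j ∈ s i, (S ∩ Metric.ball (j : ℂ) (r j))) :=
        measure_iUnion_fintype_le _ _
    _ ≤ ∑ i : Fin N, κ * volume (Metric.ball x₀ R) := by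
        refine Finset.sum_le_sum fun i _ => ?_
        calc volume (⋃ j ∈ s i, (S ∩ Metric.ball (j : ℂ) (r j)))
            ≤ ∑' j : s i, volume (S ∩ Metric.ball ((j : S) : ℂ) (r j)) :=
              measure_biUnion_le _ (hcount i) _
          _ ≤ ∑' j : s i, κ * volume (Metric.ball ((j : S) : ℂ) (r j)) :=
              ENNReal.tsum_le_tsum fun j => (h j j.1.2).2.2.2
          _ = κ * ∑' j : s i, volume (Metric.ball ((j : S) : ℂ) (r j)) := ENNReal.tsum_mul_left
          _ = κ * volume (⋃ j ∈ s i, Metric.ball (j : ℂ) (r j)) := by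
              rw [measure_biUnion (hcount i)]
              · intro a ha b hb hab
                exact (hs1 i ha hb hab).mono Metric.ball_subset_closedBall
                  Metric.ball_subset_closedBall
              · intro j _; exact measurableSet_ball
          _ ≤ κ * volume (Metric.ball x₀ R) := by
              gcongr
              exact Set.iUnion₂_subset fun j _ => (h j j.2).2.2.1
    _ = N * κ * volume (Metric.ball x₀ R) := by simp [mul_assoc]

/-- Elements compatible with a flag `F` and not in it. -/
def compat {P : Type*} [PartialOrder P] (F : Finset P) : Set P :=
  {Γ | Γ ∉ F ∧ ∀ Δ ∈ F, Γ ≤ Δ ∨ Δ ≤ Γ}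

def IsFlag {P : Type*} [PartialOrder P] (F : Finset P) : Prop :=
  ∀ a ∈ F, ∀ b ∈ F, a ≤ b ∨ b ≤ a

def Marked {P : Type*} [PartialOrder P] (ψ : P → ℂ → ℝ) (F : Finset P) (ε : ℝ) (y : ℂ) : Prop :=
  ∃ F' : Finset P, F ⊆ F' ∧ IsFlag F' ∧ (∀ Γ ∈ F', Γ ∉ F → ε ≤ ψ Γ y ∧ ψ Γ y ≤ 1) ∧
    ∀ Γ ∈ compat F', ε ≤ ψ Γ y

lemma flag_insert {P : Type*} [PartialOrder P] [DecidableEq P] {F : Finset P} (hF : IsFlag F)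
    {Γ : P} (hΓ : Γ ∈ compat F) : IsFlag (insert Γ F) := by
  intro a ha b hb
  rw [Finset.mem_insert] at ha hb
  rcases ha with rfl | ha <;> rcases hb with rfl | hb
  · exact Or.inl le_rfl
  · exact hΓ.2 b hb
  · exact (hΓ.2 a ha).symm
  · exact hF a ha b hb

lemma flag_card {P : Type*} [PartialOrder P] (rk : P → ℕ) (hrk : StrictMono rk) (k : ℕ)
    (hk : ∀ a, 1 ≤ rk a ∧ rk a ≤ k) {F : Finset P} (hF : IsFlag F) : F.card ≤ k := by
  have : F.card ≤ (Finset.Icc 1 k).card := by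
    refine Finset.card_le_card_of_injOn rk (fun a _ => by simpa using hk a) ?_
    intro a ha b hb hab
    rcases hF a ha b hb with h | h
    · by_contra hne
      exact absurd hab (hrk (lt_of_le_of_ne h hne)).ne
    · by_contra hne
      exact absurd hab.symm (hrk (lt_of_le_of_ne h (Ne.symm hne))).ne
  simpa using this

lemma exists_doubling (S : Set ℝ) (hne : S.Nonempty) (hpos : ∀ r ∈ S, 0 < r) (R : ℝ)
    (hR : ∀ r ∈ S, r < R) : ∃ r ∈ S, 2 * r ∉ S := by
  have hb : BddAbove S := ⟨R, fun r hr => (hR r hr).le⟩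
  obtain ⟨r₁, hr₁⟩ := hne
  have h0 : 0 < sSup S := (hpos r₁ hr₁).trans_le (le_csSup hb hr₁)
  obtain ⟨r, hr, hlt⟩ := exists_lt_of_lt_csSup ⟨r₁, hr₁⟩ (half_lt_self h0)
  refine ⟨r, hr, fun h => ?_⟩
  have := le_csSup hb h
  linarith

theorem nondiv {P : Type*} [PartialOrder P] (rk : P → ℕ) (hrk : StrictMono rk) (k : ℕ)
    (hk : ∀ a, 1 ≤ rk a ∧ rk a ≤ k) (C α : ℝ) (hC : 0 < C) (hα : 0 < α) (j : ℕ) :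
    ∀ ρ : ℝ, 0 < ρ → ρ ≤ 1 → ∃ K ρ' : ℝ, 0 ≤ K ∧ 0 < ρ' ∧
      ∀ (ψ : P → ℂ → ℝ) (F : Finset P), IsFlag F → k ≤ F.card + j →
      ∀ (x₀ : ℂ) (r₀ : ℝ), 0 < r₀ →
      (∀ Γ ∈ compat F, ContinuousOn (ψ Γ) (Metric.ball x₀ (5 ^ j * r₀)) ∧
        GoodOn C α (Metric.ball x₀ (5 ^ j * r₀)) (ψ Γ) ∧ ∃ y ∈ Metric.ball x₀ r₀, ρ ≤ ψ Γ y) →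
      ∀ ε : ℝ, 0 < ε → ε ≤ ρ' →
        volume {y ∈ Metric.ball x₀ r₀ | ¬ Marked ψ F ε y} ≤
          ENNReal.ofReal (K * ε ^ α) * volume (Metric.ball x₀ r₀) := by
  classical
  induction j with
  | zero =>
    intro ρ hρ hρ1
    refine ⟨0, 1, le_rfl, one_pos, ?_⟩
    intro ψ F hF hcard x₀ r₀ hr₀ hyp ε hε hε1
    have : {y ∈ Metric.ball x₀ r₀ | ¬ Marked ψ F ε y} = ∅ := by
      rw [Set.eq_empty_iff_forall_notMem]
      rintro y ⟨-, hy⟩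
      refine hy ⟨F, subset_rfl, hF, fun Γ h1 h2 => absurd h1 h2, fun Γ hΓ => ?_⟩
      have h1 := flag_card rk hrk k hk (flag_insert hF hΓ)
      rw [Finset.card_insert_of_notMem hΓ.1] at h1
      omega
    rw [this]; simp
  | succ j ih =>
    intro ρ hρ hρ1
    obtain ⟨c, hc0, hc1, hc⟩ := exists_shrink_const hC hα (s := 2) (by norm_num)
    obtain ⟨K, ρ', hK, hρ', H⟩ := ih (c * ρ) (by positivity) (by nlinarith)
    obtain ⟨N, hN⟩ := besic_cover
    refine ⟨9 * N * (C * (1 / (c * ρ)) ^ α + K), min ρ ρ', by positivity, by positivity, ?_⟩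
    intro ψ F hF hcard x₀ r₀ hr₀ hyp ε hε hερ
    set S := {y ∈ Metric.ball x₀ r₀ | ¬ Marked ψ F ε y} with hS
    have h5 : (1:ℝ) ≤ 5 ^ j := one_le_pow₀ (by norm_num)
    have key : ∀ x ∈ S, ∃ r : ℝ, 0 < r ∧ r < 2 * r₀ ∧
        volume (S ∩ Metric.ball x r) ≤
          ENNReal.ofReal ((C * (1 / (c * ρ)) ^ α + K) * ε ^ α) * volume (Metric.ball x r) := by
      rintro x ⟨hx, hxm⟩
      have hxd : dist x x₀ < r₀ := hx
      -- the set of admissible radii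
      let T : Set ℝ := {r | 0 < r ∧ ∃ Γ ∈ compat F, ∀ y ∈ Metric.ball x r, ψ Γ y < ρ}
      have hTb : ∀ r ∈ T, r < 2 * r₀ := by
        rintro r ⟨hr, Γ, hΓ, hlt⟩
        by_contra hcon
        push Not at hcon
        obtain ⟨-, -, y, hy, hyρ⟩ := hyp Γ hΓ
        have : y ∈ Metric.ball x r := by
          rw [Metric.mem_ball] at hy ⊢
          have := dist_triangle_right y x x₀
          linarith
        exact absurd (hlt y this) (not_lt.mpr hyρ)
      have hTne : T.Nonempty := by
        have : ∃ Γ ∈ compat F, ψ Γ x < ρ := by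
          by_contra hcon
          push Not at hcon
          exact hxm ⟨F, subset_rfl, hF, fun Γ h1 h2 => absurd h1 h2,
            fun Γ hΓ => (hερ.trans (min_le_left _ _)).trans (hcon Γ hΓ)⟩
        obtain ⟨Γ, hΓ, hlt⟩ := this
        have hcont := (hyp Γ hΓ).1
        have hxin : Metric.ball x₀ (5 ^ (j+1) * r₀) ∈ nhds x := by
          apply Metric.isOpen_ball.mem_nhds
          apply Metric.ball_subset_ball _ hx
          rw [pow_succ]; nlinarith
        have h1 := (hcont.continuousAt hxin).eventually (gt_mem_nhds hlt)
        rw [Metric.eventually_nhds_iff_ball] at h1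
        obtain ⟨r, hr, h2⟩ := h1
        exact ⟨r, hr, Γ, hΓ, h2⟩
      obtain ⟨r, hrT, h2r⟩ := exists_doubling T hTne (fun r hr => hr.1) _ hTb
      have hr2 := hTb r hrT
      obtain ⟨hr, Γ, hΓ, hΓlt⟩ := hrT
      have hbig : ∀ Δ ∈ compat F, ∃ y ∈ Metric.ball x r, c * ρ ≤ ψ Δ y := by
        intro Δ hΔ
        have : ∃ y ∈ Metric.ball x (2 * r), ρ ≤ ψ Δ y := by
          by_contra hcon
          push Not at hcon
          exact h2r ⟨by positivity, Δ, hΔ, hcon⟩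
        obtain ⟨y, hy, hyρ⟩ := this
        have hsub : Metric.ball x (2 * r) ⊆ Metric.ball x₀ (5 ^ (j+1) * r₀) := by
          apply Metric.ball_subset_ball'
          rw [pow_succ]; nlinarith
        obtain ⟨y', hy', h'⟩ := good_shrink (hyp Δ hΔ).2.1 hr (by norm_num) hC hsub
          (by norm_num) hc0 hc hy
        exact ⟨y', hy', le_trans (by gcongr) h'⟩
      have hsub : Metric.ball x (5 ^ j * r) ⊆ Metric.ball x₀ (5 ^ (j+1) * r₀) := by
        apply Metric.ball_subset_ball'
        rw [pow_succ]; nlinarith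
      have hcomp : compat (insert Γ F) ⊆ compat F := by
        rintro Δ ⟨h1, h2⟩
        exact ⟨fun h => h1 (Finset.mem_insert_of_mem h),
          fun Θ hΘ => h2 Θ (Finset.mem_insert_of_mem hΘ)⟩
      have hI := H ψ (insert Γ F) (flag_insert hF hΓ)
        (by rw [Finset.card_insert_of_notMem hΓ.1]; omega) x r hr
        (fun Δ hΔ => ⟨(hyp Δ (hcomp hΔ)).1.mono hsub,
          fun x' r' h' => (hyp Δ (hcomp hΔ)).2.1 x' r' (h'.trans hsub), hbig Δ (hcomp hΔ)⟩)
        ε hε (hερ.trans (min_le_right _ _))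
      refine ⟨r, hr, hr2, ?_⟩
      obtain ⟨y₁, hy₁, hψ₁⟩ := hbig Γ hΓ
      have hsub1 : Metric.ball x r ⊆ Metric.ball x₀ (5 ^ (j+1) * r₀) :=
        (Metric.ball_subset_ball (by nlinarith)).trans hsub
      have hG := (hyp Γ hΓ).2.1 x r hsub1 (ε * (1 / (c * ρ))) (by positivity) y₁ hy₁
      have hcov : S ∩ Metric.ball x r ⊆
          {y ∈ Metric.ball x r | ψ Γ y < ε * (1 / (c * ρ)) * ψ Γ y₁} ∪
          {y ∈ Metric.ball x r | ¬ Marked ψ (insert Γ F) ε y} := by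
        rintro y ⟨⟨hy0, hym⟩, hyx⟩
        by_cases hlt : ψ Γ y < ε
        · left
          refine ⟨hyx, hlt.trans_le ?_⟩
          have : 1 ≤ 1 / (c * ρ) * ψ Γ y₁ := by
            rw [one_div, inv_mul_eq_div, le_div_iff₀ (by positivity)]; linarith
          nlinarith
        · right
          refine ⟨hyx, fun hM => hym ?_⟩
          obtain ⟨F', hFF', hfl, hm1, hm2⟩ := hM
          refine ⟨F', fun a ha => hFF' (Finset.mem_insert_of_mem ha), hfl, ?_, hm2⟩
          intro Δ hΔ hΔF
          by_cases hΔΓ : Δ = Γ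
          · subst hΔΓ
            exact ⟨not_lt.mp hlt, (hΓlt y hyx).le.trans hρ1⟩
          · exact hm1 Δ hΔ (by simp [hΔΓ, hΔF])
      calc volume (S ∩ Metric.ball x r) ≤ _ := measure_mono hcov
        _ ≤ _ := measure_union_le _ _
        _ ≤ ENNReal.ofReal (C * (ε * (1 / (c * ρ))) ^ α) * volume (Metric.ball x r) +
            ENNReal.ofReal (K * ε ^ α) * volume (Metric.ball x r) := add_le_add hG hI
        _ = _ := by
          rw [← add_mul, ← ENNReal.ofReal_add (by positivity) (by positivity),
            Real.mul_rpow hε.le (by positivity)]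
          congr 2
          ring
    choose! r hr0 hr2 hrv using key
    have := hN S r (3 * r₀) x₀ _ (fun x hx => ⟨hr0 x hx, by linarith [hr2 x hx], ?_, hrv x hx⟩)
    · refine this.trans (le_of_eq ?_)
      rw [vol_ball_scale x₀ x₀ r₀ 3 (by norm_num) hr₀.le, ← mul_assoc]
      congr 1
      rw [← ENNReal.ofReal_natCast, ← ENNReal.ofReal_mul (by positivity),
        ← ENNReal.ofReal_mul (by positivity)]
      congr 1
      ring
    · apply Metric.ball_subset_ball'
      have : dist x x₀ < r₀ := hx.1
      linarith [hr2 x hx]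

lemma covol_eq {m l : ℕ} (w : Fin l → (Fin m → ℝ)) :
    covol w = Real.sqrt (Matrix.det (Matrix.of w * (Matrix.of w).transpose)) := by
  unfold covol
  congr 2

lemma covol_comb {m l : ℕ} (w w' : Fin l → (Fin m → ℝ)) (A : Matrix (Fin l) (Fin l) ℝ)
    (h : ∀ i, w' i = ∑ j, A i j • w j) : covol w' = |A.det| * covol w := by
  have h1 : Matrix.of w' = A * Matrix.of w := by
    ext i a
    simp [h, Matrix.mul_apply]
  rw [covol_eq, covol_eq, h1, Matrix.transpose_mul, Matrix.mul_assoc,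
    ← Matrix.mul_assoc (Matrix.of w), Matrix.det_mul, Matrix.det_mul, Matrix.det_transpose,
    ← Real.sqrt_sq_eq_abs, ← Real.sqrt_mul (sq_nonneg _)]
  congr 1
  ring

lemma gram_posDef {m l : ℕ} (w : Fin l → (Fin m → ℝ)) (hw : LinearIndependent ℝ w) :
    (Matrix.of w * (Matrix.of w).transpose).PosDef := by
  have := Matrix.PosDef.mul_conjTranspose_self (Matrix.of w)
    (by rw [Matrix.vecMul_injective_iff]; exact hw)
  simpa using this

lemma covol_pos {m l : ℕ} (w : Fin l → (Fin m → ℝ)) (hw : LinearIndependent ℝ w) :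
    0 < covol w := by
  rw [covol_eq]
  exact Real.sqrt_pos.mpr (gram_posDef w hw).det_pos

lemma covol_nonneg {m l : ℕ} (w : Fin l → (Fin m → ℝ)) : 0 ≤ covol w := Real.sqrt_nonneg _

lemma covol_snoc_le {m l : ℕ} (w : Fin l → (Fin m → ℝ)) (hw : LinearIndependent ℝ w)
    (v : Fin m → ℝ) :
    covol (Fin.snoc (α := fun _ => Fin m → ℝ) w v) ≤ Real.sqrt (∑ a, v a ^ 2) * covol w := by
  set G := Matrix.of w * (Matrix.of w).transpose with hG
  have hpd : G.PosDef := gram_posDef w hw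
  let b : Fin l → ℝ := fun i => ∑ a, w i a * v a
  have hdet : (Matrix.of fun i j => ∑ a, (Fin.snoc (α := fun _ => Fin m → ℝ) w v : Fin (l+1) → Fin m → ℝ) i a *
      (Fin.snoc (α := fun _ => Fin m → ℝ) w v : Fin (l+1) → Fin m → ℝ) j a).det =
      G.det * ((∑ a, v a ^ 2) - b ⬝ᵥ (G⁻¹.mulVec b)) := by
    rw [← Matrix.det_submatrix_equiv_self (finSumFinEquiv (m := l) (n := 1))]
    have : (Matrix.of fun i j => ∑ a, (Fin.snoc (α := fun _ => Fin m → ℝ) w v : Fin (l+1) → Fin m → ℝ) i a *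
      (Fin.snoc (α := fun _ => Fin m → ℝ) w v : Fin (l+1) → Fin m → ℝ) j a).submatrix
        (finSumFinEquiv (m := l) (n := 1)) (finSumFinEquiv (m := l) (n := 1)) =
        Matrix.fromBlocks G (Matrix.of fun i (_ : Fin 1) => b i)
          (Matrix.of fun (_ : Fin 1) i => b i) (Matrix.of fun _ _ => ∑ a, v a ^ 2) := by
      have e1 : ∀ i : Fin l, finSumFinEquiv (m := l) (n := 1) (Sum.inl i) = i.castSucc :=
        fun i => rfl
      have e2 : ∀ i : Fin 1, finSumFinEquiv (m := l) (n := 1) (Sum.inr i) = Fin.last l := by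
        intro i; ext; simp
      ext i j
      rcases i with i | i <;> rcases j with j | j
      · simp only [Matrix.submatrix_apply, e1, Matrix.of_apply, Fin.snoc_castSucc,
          Matrix.fromBlocks_apply₁₁]
        simp [hG, Matrix.mul_apply]
      · simp only [Matrix.submatrix_apply, e1, e2, Matrix.of_apply, Fin.snoc_castSucc,
          Fin.snoc_last, Matrix.fromBlocks_apply₁₂, b]
      · simp only [Matrix.submatrix_apply, e1, e2, Matrix.of_apply, Fin.snoc_castSucc,
          Fin.snoc_last, Matrix.fromBlocks_apply₂₁, b]
        exact Finset.sum_congr rfl fun a _ => mul_comm _ _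
      · simp only [Matrix.submatrix_apply, e2, Matrix.of_apply,
          Fin.snoc_last, Matrix.fromBlocks_apply₂₂]
        exact Finset.sum_congr rfl fun a _ => (sq _).symm
    rw [this]
    haveI : Invertible G := hpd.isUnit.invertible
    rw [Matrix.det_fromBlocks₁₁, Matrix.det_unique (n := Fin 1), Matrix.invOf_eq_nonsing_inv]
    congr 1
    simp only [Matrix.sub_apply, Matrix.of_apply]
    congr 1
    rw [Matrix.mul_assoc, Matrix.mul_apply]
    simp only [dotProduct, Matrix.of_apply]
    rfl
  unfold covol
  rw [hdet, ← Real.sqrt_mul (Finset.sum_nonneg fun a _ => sq_nonneg _)]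
  apply Real.sqrt_le_sqrt
  have h1 : 0 ≤ b ⬝ᵥ (G⁻¹.mulVec b) := by
    simpa using hpd.inv.posSemidef.dotProduct_mulVec_nonneg b
  have h2 : (Matrix.of fun i j => ∑ a, w i a * w j a) = G := by
    ext i j; simp [hG, Matrix.mul_apply]
  rw [h2]
  nlinarith [hpd.det_pos]

lemma covol_single {m : ℕ} (w : Fin 1 → (Fin m → ℝ)) :
    covol w = Real.sqrt (∑ a, w 0 a ^ 2) := by
  unfold covol
  rw [Matrix.det_unique]
  simp [sq]

/-- `w` is a minimal family of lattice vectors spanning `V`. -/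
def IsMinFam (n : ℕ) (V : Submodule ℝ (Fin (n + 2) → ℝ)) (l : ℕ)
    (w : Fin l → (Fin (n + 2) → ℝ)) : Prop :=
  (∀ i, w i ∈ LambdaSet n) ∧ LinearIndependent ℝ w ∧ Submodule.span ℝ (Set.range w) = V ∧
  ∀ w' : Fin l → (Fin (n + 2) → ℝ), (∀ i, w' i ∈ LambdaSet n) → LinearIndependent ℝ w' →
    Submodule.span ℝ (Set.range w') = V → covol w ≤ covol w'

lemma lambda_int {n : ℕ} {w : Fin (n + 2) → ℝ} (hw : w ∈ LambdaSet n) :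
    ∃ a : Fin (n + 2) → ℤ, ∀ i, w i = a i := by
  obtain ⟨p, q, rfl⟩ := hw
  refine ⟨Fin.cons p (Fin.cons 0 q), fun i => ?_⟩
  refine Fin.cases ?_ (fun i => ?_) i
  · simp [lamVec]
  · refine Fin.cases ?_ (fun i => ?_) i <;> simp [lamVec]

lemma gram_nat {n l : ℕ} (w : Fin l → (Fin (n + 2) → ℝ)) (hw : ∀ i, w i ∈ LambdaSet n) 
    (hl : LinearIndependent ℝ w) :
    ∃ k : ℕ, covol w = Real.sqrt k := by
  choose a ha using fun i => lambda_int (hw i)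
  have h1 : (Matrix.of w * (Matrix.of w).transpose).det =
      (((Matrix.of a * (Matrix.of a).transpose).det : ℤ) : ℝ) := by
    rw [Int.cast_det]
    congr 1
    ext i j
    simp [Matrix.mul_apply, ha]
  have h2 := (gram_posDef w hl).det_pos
  rw [h1] at h2
  have h3 : 0 < (Matrix.of a * (Matrix.of a).transpose).det := by exact_mod_cast h2
  refine ⟨(Matrix.of a * (Matrix.of a).transpose).det.toNat, ?_⟩
  rw [covol_eq, h1]
  congr 1
  have := Int.toNat_of_nonneg h3.le
  exact_mod_cast this.symm

lemma exists_minFam (n : ℕ) (V : Submodule ℝ (Fin (n + 2) → ℝ))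
    (hV : Submodule.span ℝ ((V : Set _) ∩ LambdaSet n) = V) :
    ∃ (l : ℕ) (w : Fin l → (Fin (n + 2) → ℝ)), IsMinFam n V l w := by
  obtain ⟨w₀, h1, h2, h3⟩ := Submodule.exists_fun_fin_finrank_span_eq ℝ ((V : Set _) ∩ LambdaSet n)
  generalize Module.finrank ℝ (Submodule.span ℝ ((V : Set _) ∩ LambdaSet n)) = l at w₀ h1 h2 h3
  let T : Set ℕ := {k | ∃ w : Fin l → (Fin (n + 2) → ℝ), (∀ i, w i ∈ LambdaSet n) ∧
    LinearIndependent ℝ w ∧ Submodule.span ℝ (Set.range w) = V ∧ covol w = Real.sqrt k}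
  have hT : T.Nonempty := by
    obtain ⟨k, hk⟩ := gram_nat w₀ (fun i => (h1 i).2) h3
    exact ⟨k, w₀, fun i => (h1 i).2, h3, h2.trans hV, hk⟩
  obtain ⟨w, hw1, hw2, hw3, hw4⟩ := Nat.sInf_mem hT
  refine ⟨l, w, hw1, hw2, hw3, fun w' ha hb hc => ?_⟩
  obtain ⟨k, hk⟩ := gram_nat w' ha hb
  rw [hw4, hk]
  apply Real.sqrt_le_sqrt
  exact_mod_cast Nat.sInf_le (show k ∈ T from ⟨w', ha, hb, hc, hk⟩)

lemma minFam_le {n l : ℕ} {V : Submodule ℝ (Fin (n + 2) → ℝ)} {w : Fin l → (Fin (n + 2) → ℝ)}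
    (hw : IsMinFam n V l w) (w' : Fin l → (Fin (n + 2) → ℝ)) (ha : ∀ i, w' i ∈ LambdaSet n)
    (hb : LinearIndependent ℝ w') (hc : Submodule.span ℝ (Set.range w') = V)
    (H : (Fin (n + 2) → ℝ) →ₗ[ℝ] (Fin (n + 2) → ℝ)) :
    covol (fun i => H (w i)) ≤ covol (fun i => H (w' i)) := by
  have h1 : ∀ i, ∃ c : Fin l → ℝ, ∑ j, c j • w j = w' i := by
    intro i
    rw [← Submodule.mem_span_range_iff_exists_fun, hw.2.2.1, ← hc]
    exact Submodule.subset_span ⟨i, rfl⟩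
  choose A hA using h1
  have e1 := covol_comb w w' (Matrix.of A) (fun i => (hA i).symm)
  have e2 := covol_comb (fun i => H (w i)) (fun i => H (w' i)) (Matrix.of A)
    (fun i => by rw [← hA i, map_sum]; simp)
  have h2 := hw.2.2.2 w' ha hb hc
  have h3 := covol_pos w hw.2.1
  have h4 : 1 ≤ |(Matrix.of A).det| := by
    by_contra hcon
    push Not at hcon
    nlinarith
  rw [e2]
  nlinarith [covol_nonneg (fun i => H (w i))]

noncomputable def hmap (n : ℕ) (t : Fin n → ℝ) (z : Fin n → ℂ) :
    (Fin (n + 2) → ℝ) →ₗ[ℝ] (Fin (n + 2) → ℝ) where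
  toFun w := gApply n t (uApply n z w)
  map_add' a b := by
    ext j
    refine Fin.cases ?_ (fun j => ?_) j
    · simp [gApply, uApply, mul_add, Finset.sum_add_distrib]; ring
    · refine Fin.cases ?_ (fun j => ?_) j <;>
      simp [gApply, uApply, mul_add, Finset.sum_add_distrib]; ring
  map_smul' c a := by
    have h : ∀ g : Fin n → ℝ, ∑ i, g i * (c * a i.succ.succ) = c * ∑ i, g i * a i.succ.succ := by
      intro g; rw [Finset.mul_sum]; exact Finset.sum_congr rfl fun i _ => by ring
    ext j
    refine Fin.cases ?_ (fun j => ?_) j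
    · simp [gApply, uApply, h]; ring
    · refine Fin.cases ?_ (fun j => ?_) j
      · simp [gApply, uApply, h]; ring
      · simp [gApply, uApply]; ring

lemma hmap_apply (n : ℕ) (t : Fin n → ℝ) (z : Fin n → ℂ) (w : Fin (n + 2) → ℝ) :
    hmap n t z w = gApply n t (uApply n z w) := rfl

lemma hmap_inj (n : ℕ) (t : Fin n → ℝ) (z : Fin n → ℂ) : LinearMap.ker (hmap n t z) = ⊥ := by
  rw [LinearMap.ker_eq_bot']
  intro w hw
  have h1 : ∀ i : Fin n, w i.succ.succ = 0 := by
    intro i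
    have := congrFun hw i.succ.succ
    simpa [hmap_apply, gApply, uApply, Real.exp_ne_zero] using this
  have h2 := congrFun hw 0
  have h3 := congrFun hw (Fin.succ 0)
  ext j
  refine Fin.cases ?_ (fun j => ?_) j
  · simpa [hmap_apply, gApply, uApply, Real.exp_ne_zero, h1] using h2
  · refine Fin.cases ?_ (fun j => ?_) j
    · simpa [hmap_apply, gApply, uApply, Real.exp_ne_zero, h1, -Fin.succ_zero_eq_one, -Fin.succ_zero_eq_one'] using h3
    · exact h1 j

/-- The poset of nonzero rational subspaces. -/
def RatSub (n : ℕ) : Type :=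
  {V : Submodule ℝ (Fin (n + 2) → ℝ) // V ≠ ⊥ ∧
    Submodule.span ℝ ((V : Set (Fin (n + 2) → ℝ)) ∩ LambdaSet n) = V}

instance (n : ℕ) : PartialOrder (RatSub n) := Subtype.partialOrder _

noncomputable def famLen (n : ℕ) (V : RatSub n) : ℕ :=
  Classical.choose (exists_minFam n V.1 V.2.2)

noncomputable def fam (n : ℕ) (V : RatSub n) : Fin (famLen n V) → (Fin (n + 2) → ℝ) :=
  Classical.choose (Classical.choose_spec (exists_minFam n V.1 V.2.2))

lemma fam_spec (n : ℕ) (V : RatSub n) : IsMinFam n V.1 (famLen n V) (fam n V) :=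
  Classical.choose_spec (Classical.choose_spec (exists_minFam n V.1 V.2.2))

noncomputable def psi (n : ℕ) (t : Fin n → ℝ) (f : ℂ → (Fin n → ℂ)) (V : RatSub n) (z : ℂ) : ℝ :=
  covol fun i => gApply n t (uApply n (f z) (fam n V i))

lemma famLen_eq (n : ℕ) (V : RatSub n) : famLen n V = Module.finrank ℝ V.1 := by
  have h := fam_spec n V
  have h1 := finrank_span_eq_card h.2.1
  rw [h.2.2.1] at h1
  simpa using h1.symm

lemma famLen_pos (n : ℕ) (V : RatSub n) : 1 ≤ famLen n V := by
  rw [famLen_eq]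
  have := (Submodule.nontrivial_iff_ne_bot).mpr V.2.1
  exact Module.finrank_pos

lemma famLen_le (n : ℕ) (V : RatSub n) : famLen n V ≤ n + 2 := by
  rw [famLen_eq]
  simpa using Submodule.finrank_le V.1

lemma famLen_strictMono (n : ℕ) : StrictMono (famLen n) := by
  intro V W h
  rw [famLen_eq, famLen_eq]
  exact Submodule.finrank_lt_finrank_of_lt h

/-- Extending a family by one vector. -/
lemma psi_extend (n : ℕ) (t : Fin n → ℝ) (f : ℂ → (Fin n → ℂ)) (y : ℂ) {l : ℕ}
    (w : Fin l → (Fin (n + 2) → ℝ)) (hwΛ : ∀ i, w i ∈ LambdaSet n) (hw : LinearIndependent ℝ w)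
    (v : Fin (n + 2) → ℝ) (hvΛ : v ∈ LambdaSet n) (hv : v ∉ Submodule.span ℝ (Set.range w))
    (V' : RatSub n) (hV' : V'.1 = Submodule.span ℝ (Set.range w) ⊔ Submodule.span ℝ {v}) :
    psi n t f V' y ≤ Real.sqrt (∑ a, (gApply n t (uApply n (f y) v)) a ^ 2) *
      covol (fun i => gApply n t (uApply n (f y) (w i))) := by
  set w' : Fin (l + 1) → (Fin (n + 2) → ℝ) := Fin.snoc (α := fun _ => Fin (n + 2) → ℝ) w v with hw'
  have hli : LinearIndependent ℝ w' := linearIndependent_finSnoc.mpr ⟨hw, hv⟩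
  have hspan : Submodule.span ℝ (Set.range w') = V'.1 := by
    rw [hV', hw', Fin.range_snoc, Submodule.span_insert, sup_comm]
  have hΛ : ∀ i, w' i ∈ LambdaSet n := by
    intro i
    refine Fin.lastCases ?_ (fun i => ?_) i
    · simpa [hw'] using hvΛ
    · simpa [hw'] using hwΛ i
  have hlen : famLen n V' = l + 1 := by
    rw [famLen_eq, ← hspan, finrank_span_eq_card hli]; simp
  have hf := fam_spec n V'
  have hpsi : psi n t f V' y = covol fun i => hmap n t (f y) (fam n V' i) := rfl
  rw [hpsi]
  generalize fam n V' = φ at hf ⊢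
  generalize famLen n V' = L at φ hlen hf ⊢
  subst hlen
  refine (minFam_le hf w' hΛ hli hspan (hmap n t (f y))).trans ?_
  have := covol_snoc_le (fun i => hmap n t (f y) (w i))
    (hw.map' _ (hmap_inj n t (f y))) (hmap n t (f y) v)
  refine le_trans (le_of_eq ?_) this
  congr 1
  funext i
  refine Fin.lastCases ?_ (fun i => ?_) i <;> simp [hw']

lemma marked_imp (n : ℕ) (t : Fin n → ℝ) (f : ℂ → (Fin n → ℂ)) (y : ℂ) (ε : ℝ)
    (hM : Marked (psi n t f) ∅ ε y) (v : Fin (n + 2) → ℝ) (hvΛ : v ∈ LambdaSet n) (hv0 : v ≠ 0) :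
    ε ≤ Real.sqrt (∑ a, (gApply n t (uApply n (f y) v)) a ^ 2) := by
  classical
  obtain ⟨F, -, hF, h1, h2⟩ := hM
  have hmem : ∀ V ∈ F, ε ≤ psi n t f V y ∧ psi n t f V y ≤ 1 := fun V hV => h1 V hV (by simp)
  have hall : ∀ V : RatSub n, (∀ Δ ∈ F, V ≤ Δ ∨ Δ ≤ V) → ε ≤ psi n t f V y := by
    intro V hV
    by_cases hVF : V ∈ F
    · exact (hmem V hVF).1
    · exact h2 V ⟨hVF, hV⟩
  by_cases hex : (F.filter fun V => v ∉ V.1).Nonempty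
  · obtain ⟨V, hVm, hVmax⟩ := Finset.exists_max_image _ (famLen n) hex
    rw [Finset.mem_filter] at hVm
    obtain ⟨hVF, hvV⟩ := hVm
    have hf := fam_spec n V
    let V' : RatSub n := ⟨V.1 ⊔ Submodule.span ℝ {v}, by
      refine ⟨ne_bot_of_le_ne_bot V.2.1 le_sup_left, le_antisymm
        (Submodule.span_le.mpr Set.inter_subset_left) (sup_le ?_ ?_)⟩
      · conv_lhs => rw [← V.2.2]
        apply Submodule.span_mono
        rintro x ⟨hx, hx'⟩
        exact ⟨(le_sup_left : V.1 ≤ _) hx, hx'⟩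
      · apply Submodule.span_mono
        rintro x rfl
        exact ⟨(le_sup_right : Submodule.span ℝ {x} ≤ V.1 ⊔ _) (Submodule.mem_span_singleton_self x), hvΛ⟩⟩
    have hle := psi_extend n t f y (fam n V) hf.1 hf.2.1 v hvΛ (by rw [hf.2.2.1]; exact hvV) V'
      (by rw [hf.2.2.1])
    have hge : ε ≤ psi n t f V' y := by
      apply hall
      intro W hW
      by_cases hvW : v ∈ W.1
      · left
        have : V ≤ W := by
          rcases hF V hVF W hW with h | h
          · exact h
          · exact absurd (h hvW) hvV
        have h3 : Submodule.span ℝ {v} ≤ W.1 := by simpa [Submodule.span_le] using hvW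
        have h4 : V.1 ≤ W.1 := this
        exact (sup_le h4 h3 : V.1 ⊔ Submodule.span ℝ {v} ≤ W.1)
      · right
        have : W ≤ V := by
          rcases hF V hVF W hW with h | h
          · rcases eq_or_lt_of_le h with h | h
            · exact h.ge
            · have h3 := hVmax W (Finset.mem_filter.mpr ⟨hW, hvW⟩)
              have h4 := famLen_strictMono n h
              omega
          · exact h
        exact le_trans this (show V.1 ≤ V.1 ⊔ _ from le_sup_left)
    have hle1 : covol (fun i => gApply n t (uApply n (f y) (fam n V i))) ≤ 1 := (hmem V hVF).2
    calc ε ≤ _ := hge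
      _ ≤ _ := hle
      _ ≤ _ * 1 := by gcongr
      _ = _ := mul_one _
  · let V' : RatSub n := ⟨Submodule.span ℝ {v}, by
      refine ⟨by simpa using hv0, le_antisymm
        (Submodule.span_le.mpr Set.inter_subset_left) ?_⟩
      apply Submodule.span_mono
      rintro x rfl
      exact ⟨Submodule.mem_span_singleton_self x, hvΛ⟩⟩
    have hle := psi_extend n t f y (Fin.elim0 : Fin 0 → (Fin (n+2) → ℝ)) (fun i => i.elim0)
      linearIndependent_empty_type v hvΛ (by simpa using hv0) V' (by simp [V'])
    have hge : ε ≤ psi n t f V' y := by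
      apply hall
      intro W hW
      left
      have : v ∈ W.1 := by
        by_contra hcon
        exact hex ⟨W, Finset.mem_filter.mpr ⟨hW, hcon⟩⟩
      show Submodule.span ℝ {v} ≤ W.1
      simpa [Submodule.span_le] using this
    refine (hge.trans hle).trans (le_of_eq ?_)
    simp [covol]

lemma psi_cont (n : ℕ) (t : Fin n → ℝ) (f : ℂ → (Fin n → ℂ)) (U : Set ℂ) (hf : ContinuousOn f U)
    (V : RatSub n) : ContinuousOn (psi n t f V) U := by
  have h1 : Continuous fun ζ : Fin n → ℂ => covol fun i => gApply n t (uApply n ζ (fam n V i)) := by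
    unfold covol
    apply Real.continuous_sqrt.comp
    apply Continuous.matrix_det
    apply continuous_matrix
    intro i j
    simp only [Matrix.of_apply]
    have key : ∀ (w : Fin (n + 2) → ℝ) (a : Fin (n + 2)),
        Continuous fun ζ : Fin n → ℂ => gApply n t (uApply n ζ w) a := by
      intro w a
      unfold gApply
      apply continuous_const.mul
      unfold uApply
      refine Fin.cases ?_ (fun a => ?_) a
      · simp only [Pi.add_apply, Fin.cons_zero]
        fun_prop
      · refine Fin.cases ?_ (fun a => ?_) a
        · simp only [Pi.add_apply, Fin.cons_succ, Fin.cons_zero]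
          fun_prop
        · simp only [Pi.add_apply, Fin.cons_succ]
          fun_prop
    exact continuous_finsetSum _ fun a _ => (key _ a).mul (key _ a)
  exact h1.comp_continuousOn hf

lemma good_of_isGoodC {C α : ℝ} {V : Set ℂ} {ψ : ℂ → ℝ} (hC : 0 < C)
    (hψ0 : ∀ z, 0 ≤ ψ z) (hcont : ContinuousOn ψ V) (hg : IsGoodC C α V ψ) : GoodOn C α V ψ := by
  intro x r hsub ε hε y₀ hy₀
  let A : ℕ → Set ℂ := fun k =>
    {y ∈ Metric.ball x (r - 1 / ((k : ℝ) + 1)) | ψ y < ε * ψ y₀ ∧ y₀ ∈ Metric.ball x (r - 1 / ((k : ℝ) + 1))}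
  have hmono : Monotone A := by
    intro a b hab y hy
    have hle : r - 1 / ((a : ℝ) + 1) ≤ r - 1 / ((b : ℝ) + 1) := by
      have : (a : ℝ) ≤ b := by exact_mod_cast hab
      gcongr
    exact ⟨Metric.ball_subset_ball hle hy.1, hy.2.1, Metric.ball_subset_ball hle hy.2.2⟩
  have hlim : ∀ y ∈ Metric.ball x r, ∃ k : ℕ, y ∈ Metric.ball x (r - 1 / ((k : ℝ) + 1)) := by
    intro y hy
    rw [Metric.mem_ball] at hy
    obtain ⟨k, hk⟩ := exists_nat_one_div_lt (sub_pos.mpr hy)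
    exact ⟨k, by rw [Metric.mem_ball]; linarith⟩
  have hU : {y ∈ Metric.ball x r | ψ y < ε * ψ y₀} ⊆ ⋃ k, A k := by
    rintro y ⟨hy, hlt⟩
    obtain ⟨k1, hk1⟩ := hlim y hy
    obtain ⟨k2, hk2⟩ := hlim y₀ hy₀
    have hle : ∀ k : ℕ, k ≤ max k1 k2 → r - 1 / ((k : ℝ) + 1) ≤ r - 1 / (((max k1 k2 : ℕ) : ℝ) + 1) := by
      intro k hk
      have : (k : ℝ) ≤ (max k1 k2 : ℕ) := by exact_mod_cast hk
      gcongr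
    exact Set.mem_iUnion.mpr ⟨max k1 k2, Metric.ball_subset_ball (hle k1 (le_max_left _ _)) hk1, hlt,
      Metric.ball_subset_ball (hle k2 (le_max_right _ _)) hk2⟩
  refine (measure_mono hU).trans ?_
  rw [(hmono.directed_le).measure_iUnion]
  refine iSup_le fun k => ?_
  set r' := r - 1 / ((k : ℝ) + 1) with hr'
  have hrr : r' < r := by rw [hr']; have : (0:ℝ) < 1 / ((k : ℝ) + 1) := by positivity
                          linarith
  by_cases hy' : y₀ ∈ Metric.ball x r'
  · have hcl : Metric.closedBall x r' ⊆ V := (Metric.closedBall_subset_ball hrr).trans hsub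
    obtain ⟨M, hM⟩ := ((isCompact_closedBall x r').bddAbove_image (hcont.mono hcl))
    have hM' : ∀ w ∈ Metric.ball x r', |ψ w| ≤ M := fun w hw => by
      rw [abs_of_nonneg (hψ0 w)]
      exact hM ⟨w, Metric.ball_subset_closedBall hw, rfl⟩
    have hsup : ψ y₀ ≤ ⨆ w ∈ Metric.ball x r', |ψ w| := by
      have hb : BddAbove (Set.range fun w => ⨆ (_ : w ∈ Metric.ball x r'), |ψ w|) := by
        refine ⟨max M 0, ?_⟩
        rintro _ ⟨w, rfl⟩
        by_cases hw : w ∈ Metric.ball x r'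
        · simp only [hw, ciSup_unique]; exact (hM' w hw).trans (le_max_left _ _)
        · simp only [hw, Real.iSup_of_isEmpty]; exact le_max_right _ _
      have := le_ciSup hb y₀
      simp only [hy', ciSup_unique] at this
      exact (le_abs_self _).trans this
    have h1 := hg x r' ((Metric.ball_subset_ball hrr.le).trans hsub) ε hε
    refine le_trans (measure_mono ?_) (h1.trans ?_)
    · rintro y ⟨hy, hlt, -⟩
      refine ⟨hy, ?_⟩
      rw [abs_of_nonneg (hψ0 y)]
      exact hlt.trans_le (by gcongr)
    · gcongr
  · have : A k = ∅ := by
      rw [Set.eq_empty_iff_forall_notMem]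
      rintro y ⟨-, -, h⟩
      exact hy' h
    rw [this]; simp

lemma exists_of_le_sup {ρ : ℝ} (hρ : 0 < ρ) {x : ℂ} {r : ℝ} {ψ : ℂ → ℝ}
    (h : ρ ≤ ⨆ z ∈ Metric.ball x r, ψ z) : ∃ y ∈ Metric.ball x r, ρ / 2 ≤ ψ y := by
  obtain ⟨y, hy⟩ := exists_lt_of_lt_ciSup (lt_of_lt_of_le (half_lt_self hρ) h)
  by_cases hw : y ∈ Metric.ball x r
  · simp only [hw, ciSup_unique] at hy
    exact ⟨y, hw, hy.le⟩
  · simp only [hw, Real.iSup_of_isEmpty] at hy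
    linarith

lemma local_bound (n : ℕ) (U : Set ℂ) (f : ℂ → (Fin n → ℂ)) (hf : ContinuousOn f U)
    (z₀ : ℂ) (r₀ : ℝ) (hr₀ : 0 < r₀) (hsub : Metric.ball z₀ ((3 : ℝ) ^ (n + 1) * r₀) ⊆ U)
    (C α ρ : ℝ) (hC : 0 < C) (hα : 0 < α) (hρ : 0 < ρ)
    (h : ∀ t : Fin n → ℝ, (∀ i, 0 ≤ t i) →
        ∀ l : ℕ, 1 ≤ l → ∀ w : Fin l → (Fin (n + 2) → ℝ),
          (∀ i, w i ∈ LambdaSet n) → LinearIndependent ℝ w →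
          IsGoodC C α (Metric.ball z₀ ((3 : ℝ) ^ (n + 1) * r₀))
            (fun z => covol fun i => gApply n t (uApply n (f z) (w i))) ∧
          ρ ≤ ⨆ z ∈ Metric.ball z₀ r₀, covol fun i => gApply n t (uApply n (f z) (w i))) :
    ∃ s : ℝ, 0 < s ∧ ∃ K : ℝ, 0 ≤ K ∧ ∀ t : Fin n → ℝ, (∀ i, 0 ≤ t i) → ∀ ε : ℝ, 0 < ε →
      volume {y ∈ Metric.ball z₀ s | ∃ v ∈ LambdaSet n, v ≠ 0 ∧
        Real.sqrt (∑ a, (gApply n t (uApply n (f y) v)) a ^ 2) < ε} ≤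
      ENNReal.ofReal (K * ε ^ α) * volume (Metric.ball z₀ s) := by
  set S : ℝ := 5 ^ (n + 2) with hS
  have hS1 : 1 ≤ S := one_le_pow₀ (by norm_num)
  have hS0 : 0 < S := by linarith
  have hSs : S * (r₀ / S) = r₀ := by field_simp
  obtain ⟨c, hc0, hc1, hc⟩ := exists_shrink_const hC hα hS1
  have hmin : 0 < min ρ 1 := by positivity
  obtain ⟨K, ρ', hK, hρ', H⟩ := nondiv (famLen n) (famLen_strictMono n) (n + 2)
    (fun a => ⟨famLen_pos n a, famLen_le n a⟩) C α hC hα (n + 2) (c * (min ρ 1 / 2))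
    (by positivity) (by nlinarith [min_le_right ρ 1])
  have hsub3 : Metric.ball z₀ r₀ ⊆ Metric.ball z₀ ((3 : ℝ) ^ (n + 1) * r₀) := by
    apply Metric.ball_subset_ball
    have : (1:ℝ) ≤ 3 ^ (n + 1) := one_le_pow₀ (by norm_num)
    nlinarith
  refine ⟨r₀ / S, by positivity, K + (1 / ρ') ^ α, by positivity, fun t ht ε hε => ?_⟩
  by_cases hερ : ε ≤ ρ'
  · have := H (psi n t f) ∅ (by intro a ha; simp at ha) (by simp) z₀ (r₀ / S) (by positivity) ?_ ε hε hερ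
    · calc _ ≤ volume {y ∈ Metric.ball z₀ (r₀ / S) | ¬ Marked (psi n t f) ∅ ε y} := by
            apply measure_mono
            rintro y ⟨hy, v, hvΛ, hv0, hlt⟩
            exact ⟨hy, fun hM => absurd (marked_imp n t f y ε hM v hvΛ hv0) (not_le.mpr hlt)⟩
        _ ≤ _ := this
        _ ≤ _ := by
            gcongr
            have : 0 ≤ (1 / ρ') ^ α := by positivity
            linarith
    · intro V _
      rw [hSs]
      have hV := h t ht (famLen n V) (famLen_pos n V) (fam n V) (fam_spec n V).1 (fam_spec n V).2.1
      have hcont := psi_cont n t f U hf V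
      have hg : GoodOn C α (Metric.ball z₀ ((3 : ℝ) ^ (n + 1) * r₀)) (psi n t f V) :=
        good_of_isGoodC hC (fun z => covol_nonneg _) (hcont.mono hsub) hV.1
      have hg' : GoodOn C α (Metric.ball z₀ r₀) (psi n t f V) :=
        fun x r hx => hg x r (hx.trans hsub3)
      refine ⟨hcont.mono (hsub3.trans hsub), hg', ?_⟩
      obtain ⟨y, hy, hyρ⟩ := exists_of_le_sup hρ hV.2
      obtain ⟨y', hy', h'⟩ := good_shrink hg' (x := z₀) (r := r₀ / S) (s := S) (by positivity)
        hS0.le hC (by rw [hSs]) hS1 hc0 hc (y₀ := y) (by rw [hSs]; exact hy)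
      refine ⟨y', hy', le_trans ?_ h'⟩
      have : min ρ 1 / 2 ≤ psi n t f V y := le_trans (by gcongr; exact min_le_left _ _) hyρ
      gcongr
  · push Not at hερ
    calc _ ≤ volume (Metric.ball z₀ (r₀ / S)) := measure_mono (fun y hy => hy.1)
      _ = 1 * volume (Metric.ball z₀ (r₀ / S)) := (one_mul _).symm
      _ ≤ _ := by
        gcongr
        rw [ENNReal.one_le_ofReal]
        have h1 : 1 ≤ (1 / ρ') ^ α * ε ^ α := by
          rw [← Real.mul_rpow (by positivity) hε.le]
          apply Real.one_le_rpow _ hα.le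
          rw [one_div, inv_mul_eq_div, le_div_iff₀ hρ']; linarith
        have h2 : 0 ≤ K * ε ^ α := by positivity
        nlinarith

lemma summable_exp_pi (c : ℝ) (hc : 0 < c) (n : ℕ) :
    Summable fun t : Fin n → ℕ => Real.exp (-c * ∑ i, (t i : ℝ)) := by
  induction n with
  | zero => exact (hasSum_fintype _).summable
  | succ n ih =>
    have h1 : Summable fun k : ℕ => Real.exp (-c * (k : ℝ)) := by
      have := Real.summable_exp_nat_mul_iff.mpr (neg_lt_zero.mpr hc)
      simpa [mul_comm] using this
    have h2 := h1.mul_of_nonneg ih (fun _ => (Real.exp_pos _).le) (fun _ => (Real.exp_pos _).le)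
    rw [← (Fin.consEquiv (fun _ : Fin (n + 1) => ℕ)).summable_iff]
    refine h2.congr fun x => ?_
    simp [Fin.consEquiv, Fin.sum_univ_succ, mul_add, Real.exp_add]

lemma bc_finite (n : ℕ) (f : ℂ → (Fin n → ℂ)) (z₀ : ℂ) (s K α γ : ℝ) (hK : 0 ≤ K) (hα : 0 < α)
    (hγ : 0 < γ)
    (h : ∀ t : Fin n → ℝ, (∀ i, 0 ≤ t i) → ∀ ε : ℝ, 0 < ε →
      volume {y ∈ Metric.ball z₀ s | ∃ v ∈ LambdaSet n, v ≠ 0 ∧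
        Real.sqrt (∑ a, (gApply n t (uApply n (f y) v)) a ^ 2) < ε} ≤
      ENNReal.ofReal (K * ε ^ α) * volume (Metric.ball z₀ s)) :
    ∀ᵐ y ∂(volume : Measure ℂ), y ∈ Metric.ball z₀ s →
      {t : Fin n → ℕ | ∃ v ∈ LambdaSet n, v ≠ 0 ∧
        Real.sqrt (∑ a, (gApply n (fun i => (t i : ℝ)) (uApply n (f y) v)) a ^ 2) <
          Real.exp (-γ * ∑ i, (t i : ℝ))}.Finite := by
  let A : (Fin n → ℕ) → Set ℂ := fun t => {y ∈ Metric.ball z₀ s | ∃ v ∈ LambdaSet n, v ≠ 0 ∧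
        Real.sqrt (∑ a, (gApply n (fun i => (t i : ℝ)) (uApply n (f y) v)) a ^ 2) <
          Real.exp (-γ * ∑ i, (t i : ℝ))}
  have hA : ∑' t, volume (A t) ≠ ⊤ := by
    have hb : ∀ t, volume (A t) ≤ ENNReal.ofReal (K * Real.exp (-(γ * α) * ∑ i, (t i : ℝ))) *
        volume (Metric.ball z₀ s) := by
      intro t
      refine (h (fun i => (t i : ℝ)) (fun i => by positivity) _ (Real.exp_pos _)).trans (le_of_eq ?_)
      rw [← Real.exp_mul]
      congr 4
      ring
    refine ne_top_of_le_ne_top ?_ (ENNReal.tsum_le_tsum hb)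
    rw [ENNReal.tsum_mul_right]
    refine ENNReal.mul_ne_top ?_ (vol_ball_ne_top _ _)
    exact ((summable_exp_pi (γ * α) (by positivity) n).mul_left K).tsum_ofReal_ne_top
  filter_upwards [ae_finite_setOf_mem hA] with y hy hyb
  refine hy.subset ?_
  intro t ht
  exact ⟨hyb, ht⟩

lemma sumsq (n : ℕ) (t : Fin n → ℝ) (z : Fin n → ℂ) (p : ℤ) (q : Fin n → ℤ) :
    ∑ a, (gApply n t (uApply n z (lamVec n p q))) a ^ 2 =
      (Real.exp ((((n : ℝ) - 1) / (2 * n)) * ∑ i, t i) *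
        ‖(∑ i, z i * (q i : ℂ)) + (p : ℂ)‖) ^ 2 + ∑ i, (Real.exp (-t i) * q i) ^ 2 := by
  rw [Fin.sum_univ_succ, Fin.sum_univ_succ, mul_pow, Complex.sq_norm, Complex.normSq_apply]
  simp [gApply, uApply, lamVec]
  ring

lemma finite_small (n : ℕ) (z : Fin n → ℂ) (M : ℝ) :
    {pq : (Fin n → ℤ) × ℤ | ‖(∑ i, z i * (pq.1 i : ℂ)) + (pq.2 : ℂ)‖ ≤ 1 ∧
      ∀ i, |(pq.1 i : ℝ)| ≤ M}.Finite := by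
  let B : ℤ := ⌈M⌉
  let B' : ℤ := ⌈(∑ i, ‖z i‖ * M) + 1⌉
  apply (((Set.finite_Icc (fun _ : Fin n => -B) (fun _ => B))).prod (Set.finite_Icc (-B') B')).subset
  rintro ⟨q, p⟩ ⟨h1, h2⟩
  simp only at h1 h2
  have hp : |(p : ℝ)| ≤ (∑ i, ‖z i‖ * M) + 1 := by
    have e : ((p : ℂ)) = ((∑ i, z i * (q i : ℂ)) + (p : ℂ)) - ∑ i, z i * (q i : ℂ) := by ring
    have : |(p : ℝ)| = ‖(p : ℂ)‖ := by simp
    rw [this, e]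
    refine (norm_sub_le _ _).trans ?_
    have : ‖∑ i, z i * (q i : ℂ)‖ ≤ ∑ i, ‖z i‖ * M := by
      refine (norm_sum_le _ _).trans (Finset.sum_le_sum fun i _ => ?_)
      rw [norm_mul]
      gcongr
      simpa using h2 i
    linarith
  refine ⟨⟨fun i => ?_, fun i => ?_⟩, ?_, ?_⟩
  · have := (abs_le.mp ((h2 i).trans (Int.le_ceil M))).1
    exact_mod_cast this
  · have := (abs_le.mp ((h2 i).trans (Int.le_ceil M))).2
    exact_mod_cast this
  · have := (abs_le.mp (hp.trans (Int.le_ceil _))).1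
    exact_mod_cast this
  · have := (abs_le.mp (hp.trans (Int.le_ceil _))).2
    exact_mod_cast this

lemma upper_det (n : ℕ) (hn : 1 ≤ n) (v : ℝ) (hv : ((n : ℝ) - 1) / 2 < v) :
    ∃ γ : ℝ, 0 < γ ∧ ∀ z : Fin n → ℂ,
      {t : Fin n → ℕ | ∃ w ∈ LambdaSet n, w ≠ 0 ∧
        Real.sqrt (∑ a, (gApply n (fun i => (t i : ℝ)) (uApply n z w)) a ^ 2) <
          Real.exp (-γ * ∑ i, (t i : ℝ))}.Finite →
      {pq : (Fin n → ℤ) × ℤ |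
        ‖(∑ i, z i * (pq.1 i : ℂ)) + (pq.2 : ℂ)‖ ≤
        (∏ i, max |(pq.1 i : ℝ)| 1) ^ (-(v / (n : ℝ)))}.Finite := by
  have hn' : (1:ℝ) ≤ n := by exact_mod_cast hn
  have hn0 : (0:ℝ) < n := by linarith
  set κ : ℝ := ((n : ℝ) - 1) / (2 * n) with hκ
  have hκ0 : 0 ≤ κ := div_nonneg (by linarith) (by linarith)
  have hκ1 : κ ≤ 1 := by rw [hκ, div_le_one (by positivity)]; linarith
  set δ : ℝ := v / n - κ with hδ
  have hδ0 : 0 < δ := by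
    have : κ = (((n : ℝ) - 1) / 2) / n := by rw [hκ]; field_simp
    rw [hδ, this, ← sub_div]
    exact div_pos (by linarith) hn0
  have hvn : 0 ≤ v / n := by linarith
  set c : ℝ := δ / (2 * n) with hc
  have hc0 : 0 < c := by positivity
  have hnc : n * c = δ / 2 := by rw [hc]; field_simp
  have hcδ : c ≤ δ / 2 := by nlinarith
  set γ : ℝ := c / (2 * (1 + n * c)) with hγ
  have hγ0 : 0 < γ := by positivity
  have hγc : γ * (1 + n * c) = c / 2 := by rw [hγ]; field_simp
  refine ⟨γ, hγ0, fun z hfin => ?_⟩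
  set D : ℝ := (Real.exp (2 * κ * n) + n) * Real.exp (2 * γ * n) with hD
  have hD0 : 0 < D := by positivity
  set M₀ : ℝ := max (Real.log D / c) 0 with hM₀
  let Lq : (Fin n → ℤ) → ℝ := fun q => ∑ i, Real.log (max |(q i : ℝ)| 1)
  let T : (Fin n → ℤ) → (Fin n → ℕ) := fun q i => ⌈Real.log (max |(q i : ℝ)| 1) + c * Lq q⌉₊
  have hX1 : ∀ (q : Fin n → ℤ) i, (1:ℝ) ≤ max |(q i : ℝ)| 1 := fun q i => le_max_right _ _
  have hX0 : ∀ (q : Fin n → ℤ) i, (0:ℝ) < max |(q i : ℝ)| 1 :=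
    fun q i => lt_of_lt_of_le one_pos (hX1 q i)
  have hlog0 : ∀ (q : Fin n → ℤ) i, 0 ≤ Real.log (max |(q i : ℝ)| 1) :=
    fun q i => Real.log_nonneg (hX1 q i)
  have hL0 : ∀ q, 0 ≤ Lq q := fun q => Finset.sum_nonneg fun i _ => hlog0 q i
  have hle_exp : ∀ (q : Fin n → ℤ) i (b : ℝ), Real.log (max |(q i : ℝ)| 1) ≤ b →
      |(q i : ℝ)| ≤ Real.exp b := by
    intro q i b hb
    calc |(q i : ℝ)| ≤ max |(q i : ℝ)| 1 := le_max_left _ _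
      _ = Real.exp (Real.log (max |(q i : ℝ)| 1)) := (Real.exp_log (hX0 q i)).symm
      _ ≤ _ := Real.exp_le_exp.mpr hb
  have hTlow : ∀ q i, Real.log (max |(q i : ℝ)| 1) + c * Lq q ≤ (T q i : ℝ) :=
    fun q i => Nat.le_ceil _
  have hThigh : ∀ q i, (T q i : ℝ) ≤ Real.log (max |(q i : ℝ)| 1) + c * Lq q + 1 := fun q i =>
    (Nat.ceil_lt_add_one (add_nonneg (hlog0 q i) (mul_nonneg hc0.le (hL0 q)))).le
  have hσ : ∀ q, ∑ i, (T q i : ℝ) ≤ (1 + n * c) * Lq q + n := by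
    intro q
    calc ∑ i, (T q i : ℝ) ≤ ∑ i, (Real.log (max |(q i : ℝ)| 1) + c * Lq q + 1) :=
          Finset.sum_le_sum fun i _ => hThigh q i
      _ = _ := by
        simp only [Finset.sum_add_distrib, Finset.sum_const, Finset.card_univ, Fintype.card_fin,
          nsmul_eq_mul]
        show Lq q + _ + _ = _
        ring
  have hprod : ∀ q : Fin n → ℤ, (∏ i, max |(q i : ℝ)| 1) ^ (-(v / (n : ℝ))) =
      Real.exp (-(v / n) * Lq q) := by
    intro q
    rw [Real.rpow_def_of_pos (Finset.prod_pos fun i _ => hX0 q i),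
      Real.log_prod (fun i _ => (hX0 q i).ne')]
    congr 1
    ring
  have hle1 : ∀ q : Fin n → ℤ, (∏ i, max |(q i : ℝ)| 1) ^ (-(v / (n : ℝ))) ≤ 1 := by
    intro q
    rw [hprod, Real.exp_le_one_iff]
    have := mul_nonneg hvn (hL0 q)
    linarith
  -- finite cover
  refine Set.Finite.subset ((finite_small n z (Real.exp M₀)).union
    (hfin.biUnion fun t _ => finite_small n z (Real.exp (∑ i, (t i : ℝ))))) ?_
  rintro ⟨q, p⟩ hqp
  simp only [Set.mem_setOf_eq] at hqp
  have hnorm1 := hqp.trans (hle1 q)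
  by_cases hLM : Lq q ≤ M₀
  · left
    refine ⟨hnorm1, fun i => hle_exp q i _ (le_trans ?_ hLM)⟩
    exact Finset.single_le_sum (f := fun i => Real.log (max |(q i : ℝ)| 1))
      (fun i _ => hlog0 q i) (Finset.mem_univ i)
  · right
    push Not at hLM
    rw [Set.mem_iUnion₂]
    refine ⟨T q, ?_, hnorm1, fun i => hle_exp q i _ ?_⟩
    · refine ⟨lamVec n p q, ⟨p, q, rfl⟩, ?_, ?_⟩
      · intro h0
        have hq0 : ∀ i, (q i : ℝ) = 0 := by
          intro i
          have := congrFun h0 i.succ.succ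
          simpa [lamVec] using this
        have : Lq q = 0 := by simp [Lq, hq0]
        have h2 : 0 ≤ M₀ := le_max_right _ _
        linarith
      · rw [sumsq, Real.sqrt_lt' (Real.exp_pos _), ← Real.exp_nat_mul]
        set L := Lq q with hL
        have hLpos : 0 ≤ L := hL0 q
        set σ := ∑ i, (T q i : ℝ) with hσd
        have hσq : σ ≤ (1 + n * c) * L + n := hσ q
        have e1 : (Real.exp (κ * σ) * ‖(∑ i, z i * (q i : ℂ)) + (p : ℂ)‖) ^ 2 ≤
            Real.exp (2 * κ * n) * Real.exp (-2 * c * L) := by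
          have : Real.exp (κ * σ) * ‖(∑ i, z i * (q i : ℂ)) + (p : ℂ)‖ ≤
              Real.exp (κ * n - c * L) := by
            calc _ ≤ Real.exp (κ * σ) * Real.exp (-(v / n) * L) := by
                  gcongr
                  exact hqp.trans (hprod q).le
              _ = Real.exp (κ * σ + -(v / n) * L) := (Real.exp_add _ _).symm
              _ ≤ _ := by
                apply Real.exp_le_exp.mpr
                have a1 : κ * σ ≤ κ * ((1 + n * c) * L + n) := by gcongr
                have a2 : v / n = δ + κ := by rw [hδ]; ring
                rw [hnc] at a1
                rw [a2]
                have a3 : κ * (δ / 2 * L) ≤ 1 * (δ / 2 * L) := by gcongr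
                have a4 : c * L ≤ δ / 2 * L := by gcongr
                nlinarith
          calc _ ≤ (Real.exp (κ * n - c * L)) ^ 2 := by gcongr
            _ = _ := by rw [← Real.exp_nat_mul, ← Real.exp_add]; congr 1; push_cast; ring
        have e2 : ∑ i, (Real.exp (-(T q i : ℝ)) * q i) ^ 2 ≤ n * Real.exp (-2 * c * L) := by
          calc _ ≤ ∑ i : Fin n, Real.exp (-2 * c * L) := by
                refine Finset.sum_le_sum fun i _ => ?_
                have h1 : |Real.exp (-(T q i : ℝ)) * q i| ≤ Real.exp (-c * L) := by
                  rw [abs_mul, abs_of_pos (Real.exp_pos _)]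
                  calc _ ≤ Real.exp (-(T q i : ℝ)) * Real.exp ((T q i : ℝ) - c * L) := by
                        gcongr
                        apply hle_exp
                        have := hTlow q i
                        linarith
                    _ = _ := by rw [← Real.exp_add]; congr 1; ring
                calc _ = |Real.exp (-(T q i : ℝ)) * q i| ^ 2 := (sq_abs _).symm
                  _ ≤ (Real.exp (-c * L)) ^ 2 := by gcongr
                  _ = _ := by rw [← Real.exp_nat_mul]; congr 1; push_cast; ring
            _ = _ := by simp
        have e3 : D < Real.exp (c * L) := by
          rw [← Real.log_lt_iff_lt_exp hD0]
          have : Real.log D / c < L := lt_of_le_of_lt (le_max_left _ _) hLM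
          rw [div_lt_iff₀ hc0] at this
          linarith
        calc _ ≤ Real.exp (2 * κ * n) * Real.exp (-2 * c * L) + n * Real.exp (-2 * c * L) :=
              add_le_add e1 e2
          _ = D * Real.exp (-2 * γ * n + -2 * c * L) := by
              rw [hD, Real.exp_add, show -2 * γ * (n:ℝ) = -(2 * γ * n) by ring, Real.exp_neg]
              field_simp
          _ < Real.exp (c * L) * Real.exp (-2 * γ * n + -2 * c * L) := by gcongr
          _ = Real.exp (-2 * (γ * (1 + n * c) * L + γ * n)) := by
              rw [← Real.exp_add, hγc]; congr 1; ring
          _ ≤ _ := by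
              apply Real.exp_le_exp.mpr
              have := mul_le_mul_of_nonneg_left hσq hγ0.le
              push_cast
              nlinarith
    · have h1 := hTlow q i
      have h2 : (T q i : ℝ) ≤ ∑ i, (T q i : ℝ) :=
        Finset.single_le_sum (f := fun i => (T q i : ℝ)) (fun i _ => by positivity) (Finset.mem_univ i)
      have h3 := mul_nonneg hc0.le (hL0 q)
      linarith

lemma dirichlet_pigeon (n : ℕ) (z : Fin n → ℂ) (Q m Y : ℕ) (hm : 0 < m)
    (hY : ∑ i, ‖z i‖ ≤ Y) (hcard : m * (2 * (m * Q * Y) + 1) < (Q + 1) ^ n) :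
    ∃ q : Fin n → ℤ, ∃ p : ℤ, q ≠ 0 ∧ (∀ i, |(q i : ℝ)| ≤ Q) ∧
      ‖(∑ i, z i * (q i : ℂ)) + (p : ℂ)‖ ≤ 2 / (m : ℝ) := by
  have hm' : (0 : ℝ) < m := by exact_mod_cast hm
  let X : (Fin n → Fin (Q + 1)) → ℂ := fun q => ∑ i, z i * ((q i : ℕ) : ℂ)
  let F : (Fin n → Fin (Q + 1)) → ℤ × ℤ := fun q =>
    (⌊(m : ℝ) * Int.fract (X q).re⌋, ⌊(m : ℝ) * (X q).im⌋)
  have hX : ∀ q, ‖X q‖ ≤ Q * Y := by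
    intro q
    calc ‖X q‖ ≤ ∑ i, ‖z i * ((q i : ℕ) : ℂ)‖ := norm_sum_le _ _
      _ ≤ ∑ i, (Q : ℝ) * ‖z i‖ := by
          apply Finset.sum_le_sum
          intro i _
          rw [norm_mul, Complex.norm_natCast, mul_comm]
          have : ((q i : ℕ) : ℝ) ≤ Q := by exact_mod_cast Nat.lt_succ_iff.mp (q i).2
          gcongr
      _ = Q * ∑ i, ‖z i‖ := by rw [Finset.mul_sum]
      _ ≤ Q * Y := by gcongr
  let T : Finset (ℤ × ℤ) := Finset.Ico (0 : ℤ) m ×ˢ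
    Finset.Icc (-((m * Q * Y : ℕ) : ℤ)) ((m * Q * Y : ℕ) : ℤ)
  have hT : T.card = m * (2 * (m * Q * Y) + 1) := by
    simp only [T, Finset.card_product, Int.card_Ico, Int.card_Icc]
    congr 1
    omega
  have hmaps : ∀ q ∈ (Finset.univ : Finset (Fin n → Fin (Q + 1))), F q ∈ T := by
    intro q _
    have him : |(X q).im| ≤ Q * Y := (Complex.abs_im_le_norm _).trans (hX q)
    have him' := abs_le.mp him
    simp only [T, F, Finset.mem_product, Finset.mem_Ico, Finset.mem_Icc]
    refine ⟨⟨?_, ?_⟩, ?_, ?_⟩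
    · exact Int.floor_nonneg.mpr (mul_nonneg hm'.le (Int.fract_nonneg _))
    · rw [Int.floor_lt]
      have := Int.fract_lt_one (X q).re
      push_cast
      nlinarith
    · rw [Int.le_floor]
      push_cast
      nlinarith
    · rw [Int.floor_le_iff]
      push_cast
      nlinarith
  obtain ⟨q, -, q', -, hne, hFF⟩ := Finset.exists_ne_map_eq_of_card_lt_of_maps_to
    (by rw [hT]; simpa using hcard) hmaps
  simp only [F, Prod.mk.injEq] at hFF
  have h1 := Int.abs_sub_lt_one_of_floor_eq_floor hFF.1
  have h2 := Int.abs_sub_lt_one_of_floor_eq_floor hFF.2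
  rw [← mul_sub, abs_mul, abs_of_pos hm'] at h1 h2
  refine ⟨fun i => ((q i : ℕ) : ℤ) - ((q' i : ℕ) : ℤ), -(⌊(X q).re⌋ - ⌊(X q').re⌋), ?_, ?_, ?_⟩
  · intro h0
    apply hne
    funext i
    have := congrFun h0 i
    simp only [Pi.zero_apply] at this
    apply Fin.ext
    omega
  · intro i
    have h1 : ((q i : ℕ) : ℝ) ≤ Q := by exact_mod_cast Nat.lt_succ_iff.mp (q i).2
    have h2 : ((q' i : ℕ) : ℝ) ≤ Q := by exact_mod_cast Nat.lt_succ_iff.mp (q' i).2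
    have h3 : (0 : ℝ) ≤ ((q i : ℕ) : ℝ) := by positivity
    have h4 : (0 : ℝ) ≤ ((q' i : ℕ) : ℝ) := by positivity
    push_cast
    rw [abs_le]
    constructor <;> linarith
  · have hsum : (∑ i, z i * (((((q i : ℕ) : ℤ) - ((q' i : ℕ) : ℤ)) : ℤ) : ℂ)) = X q - X q' := by
      simp only [X]
      rw [← Finset.sum_sub_distrib]
      apply Finset.sum_congr rfl
      intro i _
      push_cast
      ring
    rw [hsum]
    refine (Complex.norm_le_abs_re_add_abs_im _).trans ?_
    have hre : (X q - X q' + ((-(⌊(X q).re⌋ - ⌊(X q').re⌋) : ℤ) : ℂ)).re =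
        Int.fract (X q).re - Int.fract (X q').re := by
      rw [Complex.add_re, Complex.sub_re, Complex.intCast_re]
      simp only [Int.fract]
      push_cast
      ring
    have him : (X q - X q' + ((-(⌊(X q).re⌋ - ⌊(X q').re⌋) : ℤ) : ℂ)).im =
        (X q).im - (X q').im := by
      rw [Complex.add_im, Complex.sub_im, Complex.intCast_im]
      ring
    rw [hre, him, le_div_iff₀ hm']
    nlinarith

lemma lower_inf (n : ℕ) (z : Fin n → ℂ) (v : ℝ) (hv0 : 0 < v) (hv : v < ((n : ℝ) - 1) / 2) :
    {pq : (Fin n → ℤ) × ℤ |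
        ‖(∑ i, z i * (pq.1 i : ℂ)) + (pq.2 : ℂ)‖ ≤
        (∏ i, max |(pq.1 i : ℝ)| 1) ^ (-(v / (n : ℝ)))}.Infinite := by
  obtain ⟨k, rfl⟩ : ∃ k, n = k + 2 := by
    have : (1 : ℝ) < n := by linarith
    have : 1 < n := by exact_mod_cast this
    exact ⟨n - 2, by omega⟩
  set S := {pq : (Fin (k + 2) → ℤ) × ℤ |
        ‖(∑ i, z i * (pq.1 i : ℂ)) + (pq.2 : ℂ)‖ ≤
        (∏ i, max |(pq.1 i : ℝ)| 1) ^ (-(v / ((k + 2 : ℕ) : ℝ)))} with hS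
  have hPi : ∀ q : Fin (k + 2) → ℤ, 1 ≤ ∏ i, max |(q i : ℝ)| 1 := fun q =>
    Finset.one_le_prod (fun i _ => le_max_right _ _)
  by_cases hz : ∃ q : Fin (k + 2) → ℤ, ∃ p : ℤ, q ≠ 0 ∧ (∑ i, z i * (q i : ℂ)) + (p : ℂ) = 0
  · obtain ⟨q, p, hq, h0⟩ := hz
    apply Set.infinite_of_injective_forall_mem (f := fun j : ℕ => ((fun i => (j : ℤ) * q i),
      (j : ℤ) * p))
    · intro a b hab
      simp only [Prod.mk.injEq] at hab
      obtain ⟨i, hi⟩ := Function.ne_iff.mp hq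
      have := congrFun hab.1 i
      exact_mod_cast mul_right_cancel₀ hi this
    · intro j
      have : (∑ i, z i * (((j : ℤ) * q i : ℤ) : ℂ)) + (((j : ℤ) * p : ℤ) : ℂ) = 0 := by
        calc _ = (j : ℂ) * ((∑ i, z i * (q i : ℂ)) + (p : ℂ)) := by
              rw [mul_add, Finset.mul_sum]
              push_cast
              congr 1
              apply Finset.sum_congr rfl
              intro i _
              ring
          _ = 0 := by rw [h0, mul_zero]
      change ‖(∑ i, z i * (((j : ℤ) * q i : ℤ) : ℂ)) + (((j : ℤ) * p : ℤ) : ℂ)‖ ≤ _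
      rw [this, norm_zero]
      exact Real.rpow_nonneg (zero_le_one.trans (hPi _)) _
  · push Not at hz
    intro hfin
    have hδ : ∃ δ : ℝ, 0 < δ ∧ ∀ pq ∈ S, pq.1 ≠ 0 →
        δ ≤ ‖(∑ i, z i * (pq.1 i : ℂ)) + (pq.2 : ℂ)‖ := by
      let T := S ∩ {pq | pq.1 ≠ 0}
      have hTf : T.Finite := hfin.subset Set.inter_subset_left
      rcases T.eq_empty_or_nonempty with hT | hT
      · refine ⟨1, one_pos, fun pq h1 h2 => ?_⟩
        have : pq ∈ T := ⟨h1, h2⟩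
        rw [hT] at this
        exact this.elim
      · obtain ⟨a, ha, hmin⟩ := Set.exists_min_image T
          (fun pq => ‖(∑ i, z i * (pq.1 i : ℂ)) + (pq.2 : ℂ)‖) hTf hT
        exact ⟨_, norm_pos_iff.mpr (hz a.1 a.2 ha.2), fun pq h1 h2 => hmin pq ⟨h1, h2⟩⟩
    obtain ⟨δ, hδ0, hδ⟩ := hδ
    obtain ⟨Y, hY⟩ := exists_nat_ge (max 1 (∑ i, ‖z i‖))
    have hY1 : 1 ≤ Y := by
      have : (1 : ℝ) ≤ Y := (le_max_left _ _).trans hY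
      exact_mod_cast this
    have hY2 : ∑ i, ‖z i‖ ≤ Y := (le_max_right _ _).trans hY
    set R : ℕ := 3 * Y + 1 with hR
    have hv' : 0 < ((k : ℝ) + 1) - 2 * v := by
      push_cast at hv
      linarith
    have ev1 : ∀ᶠ N : ℕ in Filter.atTop, 2 * (R : ℝ) ^ v ≤ (N : ℝ) ^ (((k : ℝ) + 1) - 2 * v) :=
      ((tendsto_rpow_atTop hv').comp tendsto_natCast_atTop_atTop).eventually_ge_atTop _
    have ev2 : ∀ᶠ N : ℕ in Filter.atTop, 2 / δ + 1 ≤ (N : ℝ) :=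
      tendsto_natCast_atTop_atTop.eventually_ge_atTop _
    obtain ⟨N, hN1, hN2, hN3⟩ := (ev1.and (ev2.and (Filter.eventually_ge_atTop 1))).exists
    have hNr : (1 : ℝ) ≤ N := by exact_mod_cast hN3
    have hN0 : (0 : ℝ) < N := by linarith
    have hRr : (1 : ℝ) ≤ R := by rw [hR]; push_cast; have : (0:ℝ) ≤ Y := by positivity
                                 linarith
    have hmpos : 0 < N ^ (k + 1) := by positivity
    have hQpos : 1 ≤ R * N ^ 2 := Nat.one_le_iff_ne_zero.mpr (by positivity)
    have hcard : N ^ (k + 1) * (2 * (N ^ (k + 1) * (R * N ^ 2) * Y) + 1) <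
        (R * N ^ 2 + 1) ^ (k + 2) := by
      set m := N ^ (k + 1) with hmdef
      set Q := R * N ^ 2 with hQdef
      have e1 : 1 ≤ m * Q * Y := Nat.one_le_iff_ne_zero.mpr (by positivity)
      have e2 : R * (m * m) ≤ Q ^ (k + 1) := by
        have : Q ^ (k + 1) = R ^ (k + 1) * (m * m) := by
          rw [hQdef, hmdef, mul_pow]
          ring
        rw [this]
        exact Nat.mul_le_mul_right _ (Nat.le_self_pow (by omega) R)
      calc m * (2 * (m * Q * Y) + 1) ≤ m * (2 * (m * Q * Y) + m * Q * Y) := by gcongr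
        _ = (3 * Y) * (m * m * Q) := by ring
        _ ≤ R * (m * m * Q) := Nat.mul_le_mul_right _ (by omega)
        _ = R * (m * m) * Q := by ring
        _ ≤ Q ^ (k + 1) * Q := Nat.mul_le_mul_right _ e2
        _ = Q ^ (k + 2) := by ring
        _ < (Q + 1) ^ (k + 2) := Nat.pow_lt_pow_left (by omega) (by omega)
    obtain ⟨q, p, hq0, hqQ, hqp⟩ := dirichlet_pigeon (k + 2) z _ _ Y hmpos hY2 hcard
    have hQr : (1 : ℝ) ≤ ((R * N ^ 2 : ℕ) : ℝ) := by exact_mod_cast hQpos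
    have hPQ : ∏ i, max |(q i : ℝ)| 1 ≤ ((R * N ^ 2 : ℕ) : ℝ) ^ (k + 2) := by
      calc ∏ i, max |(q i : ℝ)| 1 ≤ ∏ _i : Fin (k + 2), ((R * N ^ 2 : ℕ) : ℝ) :=
            Finset.prod_le_prod (fun i _ => by positivity) (fun i _ => max_le (hqQ i) hQr)
        _ = _ := by simp
    have hmem : (q, p) ∈ S := by
      change ‖(∑ i, z i * (q i : ℂ)) + (p : ℂ)‖ ≤
        (∏ i, max |(q i : ℝ)| 1) ^ (-(v / ((k + 2 : ℕ) : ℝ)))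
      refine hqp.trans ?_
      have h1 : (((R * N ^ 2 : ℕ) : ℝ) ^ (k + 2)) ^ (-(v / ((k + 2 : ℕ) : ℝ))) ≤
          (∏ i, max |(q i : ℝ)| 1) ^ (-(v / ((k + 2 : ℕ) : ℝ))) :=
        Real.rpow_le_rpow_of_nonpos (zero_lt_one.trans_le (hPi q)) hPQ
          (by rw [neg_nonpos]; positivity)
      refine le_trans ?_ h1
      have h2 : (((R * N ^ 2 : ℕ) : ℝ) ^ (k + 2)) ^ (-(v / ((k + 2 : ℕ) : ℝ))) =
          ((R : ℝ) ^ v * (N : ℝ) ^ (2 * v))⁻¹ := by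
        rw [← Real.rpow_natCast, ← Real.rpow_mul (by positivity)]
        have : ((k + 2 : ℕ) : ℝ) * (-(v / ((k + 2 : ℕ) : ℝ))) = -v := by
          field_simp
        rw [this, Real.rpow_neg (by positivity)]
        congr 1
        push_cast
        rw [Real.mul_rpow (by positivity) (by positivity), Real.rpow_mul (by positivity)]
        norm_num
      rw [h2]
      push_cast
      rw [Real.rpow_sub hN0] at hN1
      have h3 : (N : ℝ) ^ ((k : ℝ) + 1) = (N : ℝ) ^ (k + 1) := by
        rw [← Real.rpow_natCast]; push_cast; rfl
      rw [h3, le_div_iff₀ (by positivity)] at hN1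
      rw [div_le_iff₀ (by positivity), inv_mul_eq_div, le_div_iff₀ (by positivity)]
      linarith
    have h5 := (hδ _ hmem hq0).trans hqp
    have h6 : (N : ℝ) ≤ (N : ℝ) ^ (k + 1) := le_self_pow₀ hNr (by omega)
    push_cast at h5
    rw [le_div_iff₀ (by positivity)] at h5
    have h7 : 2 / δ + 1 ≤ (N : ℝ) ^ (k + 1) := hN2.trans h6
    have h8 : δ * (2 / δ + 1) ≤ δ * (N : ℝ) ^ (k + 1) := by gcongr
    have h9 : δ * (2 / δ + 1) = 2 + δ := by field_simp
    linarith

lemma omega_ge (n : ℕ) (z : Fin n → ℂ) :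
    ENNReal.ofReal (((n : ℝ) - 1) / 2) ≤ omegaMul n z := by
  apply le_of_forall_lt
  intro c hc
  have hct : c ≠ ⊤ := ne_top_of_lt hc
  have h1 : c.toReal < ((n : ℝ) - 1) / 2 := (ENNReal.lt_ofReal_iff_toReal_lt hct).mp hc
  obtain ⟨v, hv1, hv2⟩ := exists_between h1
  have hv0 : 0 < v := ENNReal.toReal_nonneg.trans_lt hv1
  have h2 : c < ENNReal.ofReal v := (ENNReal.lt_ofReal_iff_toReal_lt hct).mpr hv1
  exact h2.trans_le (le_sSup ⟨v, ⟨hv0, lower_inf n z v hv0 hv2⟩, rfl⟩)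

lemma omega_le (n : ℕ) (z : Fin n → ℂ)
    (h : ∀ m : ℕ, {pq : (Fin n → ℤ) × ℤ |
        ‖(∑ i, z i * (pq.1 i : ℂ)) + (pq.2 : ℂ)‖ ≤
        (∏ i, max |(pq.1 i : ℝ)| 1) ^
          (-((((n : ℝ) - 1) / 2 + 1 / ((m : ℝ) + 1)) / (n : ℝ)))}.Finite) :
    omegaMul n z ≤ ENNReal.ofReal (((n : ℝ) - 1) / 2) := by
  apply sSup_le
  rintro _ ⟨v, ⟨hv0, hv⟩, rfl⟩
  apply ENNReal.ofReal_le_ofReal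
  by_contra hlt
  push Not at hlt
  obtain ⟨m, hm⟩ := exists_nat_one_div_lt (sub_pos.mpr hlt)
  apply hv
  refine (h m).subset ?_
  intro pq hpq
  simp only [Set.mem_setOf_eq] at hpq ⊢
  refine le_trans hpq ?_
  apply Real.rpow_le_rpow_of_exponent_le
    (Finset.one_le_prod (fun i _ => le_max_right _ _))
  have : ((n : ℝ) - 1) / 2 + 1 / ((m : ℝ) + 1) ≤ v := by linarith
  rw [neg_le_neg_iff]
  gcongr

theorem corollary_two_seven (n : ℕ) (hn : 1 ≤ n) (U : Set ℂ) (hUo : IsOpen U)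
    (f : ℂ → (Fin n → ℂ)) (hf : ContinuousOn f U)
    (h : ∀ᵐ z₀ ∂(volume : Measure ℂ), z₀ ∈ U →
      ∃ r₀ : ℝ, 0 < r₀ ∧ Metric.ball z₀ ((3 : ℝ) ^ (n + 1) * r₀) ⊆ U ∧
      ∃ C α ρ : ℝ, 0 < C ∧ 0 < α ∧ 0 < ρ ∧
        ∀ t : Fin n → ℝ, (∀ i, 0 ≤ t i) →
        ∀ l : ℕ, 1 ≤ l → ∀ w : Fin l → (Fin (n + 2) → ℝ),
          (∀ i, w i ∈ LambdaSet n) → LinearIndependent ℝ w →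
          IsGoodC C α (Metric.ball z₀ ((3 : ℝ) ^ (n + 1) * r₀))
            (fun z => covol fun i => gApply n t (uApply n (f z) (w i))) ∧
          ρ ≤ ⨆ z ∈ Metric.ball z₀ r₀, covol fun i => gApply n t (uApply n (f z) (w i))) :
    ∀ᵐ z ∂(volume : Measure ℂ), z ∈ U →
      omegaMul n (f z) = ENNReal.ofReal (((n : ℝ) - 1) / 2) := by
  have key : ∀ m : ℕ, ∀ᵐ z ∂(volume : Measure ℂ), z ∈ U →
      {pq : (Fin n → ℤ) × ℤ |
        ‖(∑ i, f z i * (pq.1 i : ℂ)) + (pq.2 : ℂ)‖ ≤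
        (∏ i, max |(pq.1 i : ℝ)| 1) ^
          (-((((n : ℝ) - 1) / 2 + 1 / ((m : ℝ) + 1)) / (n : ℝ)))}.Finite := by
    intro m
    obtain ⟨γ, hγ, hup⟩ := upper_det n hn (((n : ℝ) - 1) / 2 + 1 / ((m : ℝ) + 1))
      (by have : 0 < 1 / ((m : ℝ) + 1) := by positivity
          linarith)
    let P : ℂ → Prop := fun z => {pq : (Fin n → ℤ) × ℤ |
        ‖(∑ i, f z i * (pq.1 i : ℂ)) + (pq.2 : ℂ)‖ ≤
        (∏ i, max |(pq.1 i : ℝ)| 1) ^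
          (-((((n : ℝ) - 1) / 2 + 1 / ((m : ℝ) + 1)) / (n : ℝ)))}.Finite
    let H : ℂ → Prop := fun z₀ => ∃ s : ℝ, 0 < s ∧
      ∀ᵐ y ∂(volume : Measure ℂ), y ∈ Metric.ball z₀ s → P y
    have hH : ∀ᵐ z₀ ∂(volume : Measure ℂ), z₀ ∈ U → H z₀ := by
      filter_upwards [h] with z₀ hz₀ hzU
      obtain ⟨r₀, hr₀, hsub, C, α, ρ, hC, hα, hρ, hh⟩ := hz₀ hzU
      obtain ⟨s, hs, K, hK, hb⟩ := local_bound n U f hf z₀ r₀ hr₀ hsub C α ρ hC hα hρ hh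
      refine ⟨s, hs, ?_⟩
      filter_upwards [bc_finite n f z₀ s K α γ hK hα hγ hb] with y hy hyb
      exact hup (f y) (hy hyb)
    have hnull : volume {z | H z ∧ ¬ P z} = 0 := by
      apply measure_null_of_locally_null
      rintro z ⟨⟨s, hs, hz⟩, -⟩
      refine ⟨Metric.ball z s ∩ {z | H z ∧ ¬ P z},
        Filter.inter_mem (mem_nhdsWithin_of_mem_nhds (Metric.ball_mem_nhds z hs))
          self_mem_nhdsWithin, ?_⟩
      refine measure_mono_null ?_ (ae_iff.mp hz)
      rintro y ⟨hy1, -, hy2⟩ hy3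
      exact hy2 (hy3 hy1)
    have hnull' : ∀ᵐ z ∂(volume : Measure ℂ), ¬ (H z ∧ ¬ P z) := by
      rw [ae_iff]; simpa using hnull
    filter_upwards [hH, hnull'] with z h1 h2 hzU
    by_contra hP
    exact h2 ⟨h1 hzU, hP⟩
  filter_upwards [ae_all_iff.mpr key] with z hz hzU
  exact le_antisymm (omega_le n (f z) fun m => hz m hzU) (omega_ge n (f z))
end

section
/- Let n ≥ 1. For Lebesgue-almost every z ∈ ℂⁿ (identifying ℂⁿ with ℝ^{2n}), ω^×(z) = (n−1)/2. -/
open MeasureTheory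

noncomputable def PP {n : ℕ} (q : Fin n → ℤ) : ℝ := ∏ i, max |(q i : ℝ)| 1

lemma one_le_PP {n : ℕ} (q : Fin n → ℤ) : 1 ≤ PP q := by
  unfold PP
  calc (1:ℝ) = ∏ i : Fin n, 1 := by simp
    _ ≤ _ := Finset.prod_le_prod (fun i _ => zero_le_one) (fun i _ => le_max_right _ _)

lemma PP_le {n : ℕ} (q : Fin n → ℤ) (N : ℝ) (hN : 1 ≤ N) (h : ∀ i, |(q i : ℝ)| ≤ N) :
    PP q ≤ N ^ n := by
  unfold PP
  calc _ ≤ ∏ i : Fin n, N :=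
        Finset.prod_le_prod (fun i _ => by positivity) (fun i _ => max_le (h i) hN)
    _ = N ^ n := by simp

lemma summable_one (s : ℝ) (hs : 1 < s) :
    Summable fun k : ℤ => (max |(k : ℝ)| 1) ^ (-s) := by
  have h := (Real.summable_abs_int_rpow hs)
  refine (summable_congr_cofinite ?_).mpr h
  rw [Filter.eventuallyEq_iff_exists_mem]
  refine ⟨{0}ᶜ, (Set.finite_singleton (0:ℤ)).compl_mem_cofinite, ?_⟩
  intro k hk
  have : (1:ℝ) ≤ |(k:ℝ)| := by
    have := Int.one_le_abs hk
    exact_mod_cast this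
  simp [max_eq_left this]

lemma summable_PP (s : ℝ) (hs : 1 < s) :
    ∀ n : ℕ, Summable fun q : Fin n → ℤ => (PP q) ^ (-s) := by
  intro n
  induction n with
  | zero => exact Summable.of_finite
  | succ n ih =>
    rw [← (Fin.consEquiv (fun _ => ℤ)).summable_iff]
    have := (summable_one s hs).mul_of_nonneg ih (fun k => by positivity)
      (fun q => Real.rpow_nonneg (zero_le_one.trans (one_le_PP q)) _)
    refine this.congr ?_
    rintro ⟨k, q⟩
    simp only [Function.comp, PP, Fin.prod_univ_succ, Fin.consEquiv]
    simp
    rw [Real.mul_rpow (by positivity) (by positivity)]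

lemma meas_bound (m : ℕ) (q : Fin (m+1) → ℤ) (j : Fin (m+1)) (hj : q j ≠ 0) (c : ℂ) (R ψ : ℝ) :
    volume {z : Fin (m+1) → ℂ | ‖z‖ ≤ R ∧ ‖(∑ i, z i * (q i : ℂ)) + c‖ ≤ ψ} ≤
      volume (Metric.closedBall (0 : Fin m → ℂ) R) *
        (ENNReal.ofReal (ψ / |(q j : ℝ)|) ^ 2 * NNReal.pi) := by
  set T : Set (ℂ × (Fin m → ℂ)) := {w | ‖w.2‖ ≤ R ∧
    ‖(w.1 * (q j : ℂ) + ∑ i, w.2 i * (q (j.succAbove i) : ℂ)) + c‖ ≤ ψ} with hT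
  have hTm : MeasurableSet T := by
    have c1 : IsClosed {w : ℂ × (Fin m → ℂ) | ‖w.2‖ ≤ R} :=
      isClosed_le (by fun_prop) (by fun_prop)
    have c2 : IsClosed {w : ℂ × (Fin m → ℂ) |
        ‖(w.1 * (q j : ℂ) + ∑ i, w.2 i * (q (j.succAbove i) : ℂ)) + c‖ ≤ ψ} :=
      isClosed_le (by fun_prop) (by fun_prop)
    exact (c1.inter c2).measurableSet
  have hmp := volume_preserving_piFinSuccAbove (fun _ : Fin (m+1) => ℂ) j
  have hsub : {z : Fin (m+1) → ℂ | ‖z‖ ≤ R ∧ ‖(∑ i, z i * (q i : ℂ)) + c‖ ≤ ψ} ⊆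
      (MeasurableEquiv.piFinSuccAbove (fun _ : Fin (m+1) => ℂ) j) ⁻¹' T := by
    rintro z ⟨h1, h2⟩
    have hR : 0 ≤ R := (norm_nonneg _).trans h1
    refine ⟨?_, ?_⟩
    · rw [pi_norm_le_iff_of_nonneg hR]
      intro i
      exact (norm_le_pi_norm z _).trans h1
    · rw [Fin.sum_univ_succAbove _ j] at h2
      exact h2
  refine (measure_mono hsub).trans ?_
  rw [hmp.measure_preimage hTm.nullMeasurableSet, Measure.volume_eq_prod,
    Measure.prod_apply_symm hTm]
  calc _ ≤ ∫⁻ y, (Metric.closedBall (0 : Fin m → ℂ) R).indicator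
        (fun _ => (ENNReal.ofReal (ψ / |(q j : ℝ)|) ^ 2 * NNReal.pi : ENNReal)) y ∂volume := by
        refine lintegral_mono fun y => ?_
        by_cases hy : y ∈ Metric.closedBall (0 : Fin m → ℂ) R
        · rw [Set.indicator_of_mem hy]
          have hq : (q j : ℂ) ≠ 0 := by exact_mod_cast hj
          have hq0 : 0 < |(q j : ℝ)| := by
            rw [abs_pos]; exact_mod_cast hj
          set d : ℂ := (∑ i, y i * (q (j.succAbove i) : ℂ)) + c with hd
          rw [← Complex.volume_closedBall (-(d / (q j : ℂ)))]
          refine measure_mono ?_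
          rintro w ⟨-, hw⟩
          simp only at hw
          rw [Metric.mem_closedBall, dist_eq_norm, le_div_iff₀ hq0]
          have : |(q j : ℝ)| = ‖(q j : ℂ)‖ := by simp
          rw [this, ← norm_mul]
          have e : (w - -(d / (q j : ℂ))) * (q j : ℂ) = w * (q j : ℂ) + d := by
            rw [sub_neg_eq_add, add_mul, div_mul_cancel₀ _ hq]
          rw [e, hd, ← add_assoc]
          exact hw
        · rw [Set.indicator_of_notMem hy]
          have : ((fun x => (x, y)) ⁻¹' T : Set ℂ) = ∅ := by
            ext w
            simp only [Set.mem_preimage, Set.mem_empty_iff_false, iff_false]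
            rintro ⟨h, -⟩
            exact hy (by simpa using h)
          rw [this]; simp
    _ = _ := by
        rw [lintegral_indicator_const Metric.isClosed_closedBall.measurableSet, mul_comm]

lemma real_bound (m : ℕ) (P N p C δ v : ℝ) (hP : 1 ≤ P) (hN : 1 ≤ N) (hPN : P ≤ N ^ (m+1))
    (hC : 1 ≤ C) (hp : |p| ≤ C * N) (hδ : 0 < δ) (hδ1 : δ ≤ 1) (hv : v = m / 2 + δ) :
    (P ^ (-(v / ((m+1 : ℕ) : ℝ))) / N) ^ 2 ≤
      C ^ (1 + δ) * (P ^ (-(1 + δ / (m+1))) * (max |p| 1) ^ (-(1 + δ))) := by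
  have hP0 : 0 < P := by linarith
  have hN0 : 0 < N := by linarith
  have hm : (0:ℝ) < m + 1 := by positivity
  have e1 : (P ^ (-(v / ((m+1 : ℕ) : ℝ))) / N) ^ 2
      = P ^ (-(2 * v / (m+1))) * (N ^ (-(1 - δ)) * N ^ (-(1 + δ))) := by
    rw [← Real.rpow_add hN0, div_pow, ← Real.rpow_natCast, ← Real.rpow_mul hP0.le, div_eq_mul_inv,
      ← Real.rpow_natCast N, ← Real.rpow_neg hN0.le]
    congr 2
    · push_cast; ring
    · push_cast; ring
  have h1 : N ^ (-(1 - δ)) ≤ P ^ (-((1 - δ) / (m+1))) := by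
    have : N ^ (-(1-δ)) = (N ^ (m+1)) ^ (-((1 - δ) / (m+1))) := by
      rw [← Real.rpow_natCast, ← Real.rpow_mul hN0.le]
      congr 1; push_cast; field_simp
    rw [this]
    apply Real.rpow_le_rpow_of_nonpos hP0 hPN
    have : 0 ≤ (1 - δ) / (m+1) := div_nonneg (by linarith) hm.le
    linarith
  have h2 : N ^ (-(1 + δ)) ≤ C ^ (1 + δ) * (max |p| 1) ^ (-(1 + δ)) := by
    have hM : max |p| 1 ≤ C * N := max_le hp (by nlinarith)
    have : (C * N) ^ (-(1+δ)) ≤ (max |p| 1) ^ (-(1+δ)) :=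
      Real.rpow_le_rpow_of_nonpos (by positivity) hM (by linarith)
    calc N ^ (-(1 + δ)) = C ^ (1 + δ) * (C * N) ^ (-(1+δ)) := by
          rw [Real.mul_rpow (by linarith) hN0.le, ← mul_assoc, ← Real.rpow_add (by linarith)]
          simp
      _ ≤ _ := by gcongr
  have e2 : P ^ (-(1 + δ / (m+1))) = P ^ (-(2 * v / (m+1))) * P ^ (-((1 - δ) / (m+1))) := by
    rw [← Real.rpow_add hP0]; congr 1; rw [hv]; field_simp; ring
  rw [e1, e2]
  calc _ ≤ P ^ (-(2 * v / (m+1))) * (P ^ (-((1 - δ) / (m+1))) *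
        (C ^ (1 + δ) * (max |p| 1) ^ (-(1 + δ)))) := by gcongr
    _ = _ := by ring

lemma upper_aux (m : ℕ) (δ v R : ℝ) (hδ : 0 < δ) (hδ1 : δ ≤ 1) (hv : v = m / 2 + δ) (hR : 0 ≤ R) :
    ∀ᵐ z ∂(volume : Measure (Fin (m+1) → ℂ)), ‖z‖ ≤ R →
      {pq : (Fin (m+1) → ℤ) × ℤ | ‖(∑ i, z i * (pq.1 i : ℂ)) + (pq.2 : ℂ)‖ ≤
        (PP pq.1) ^ (-(v / ((m+1 : ℕ) : ℝ)))}.Finite := by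
  have hv0 : 0 ≤ v := by rw [hv]; positivity
  have hψ : ∀ q : Fin (m+1) → ℤ, PP q ^ (-(v / ((m+1 : ℕ) : ℝ))) ≤ 1 := fun q =>
    Real.rpow_le_one_of_one_le_of_nonpos (one_le_PP q)
      (by have : 0 ≤ v / ((m+1 : ℕ) : ℝ) := by positivity
          linarith)
  set C : ℝ := 1 + (m+1) * R with hC
  have hC1 : 1 ≤ C := by rw [hC]; have : 0 ≤ (m+1) * R := by positivity
                         linarith
  set E : (Fin (m+1) → ℤ) × ℤ → Set (Fin (m+1) → ℂ) := fun pq =>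
    {z | pq.1 ≠ 0 ∧ ‖z‖ ≤ R ∧ ‖(∑ i, z i * (pq.1 i : ℂ)) + (pq.2 : ℂ)‖ ≤
        (PP pq.1) ^ (-(v / ((m+1 : ℕ) : ℝ)))} with hE
  set B : ENNReal := volume (Metric.closedBall (0 : Fin m → ℂ) R) * NNReal.pi with hB
  have hBt : B ≠ ⊤ := ENNReal.mul_ne_top (by exact measure_closedBall_lt_top.ne) ENNReal.coe_ne_top
  set F : (Fin (m+1) → ℤ) × ℤ → ℝ := fun pq =>
    C ^ (1 + δ) * (PP pq.1 ^ (-(1 + δ / (m+1))) * (max |(pq.2 : ℝ)| 1) ^ (-(1 + δ))) with hF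
  have hFs : Summable F := by
    apply Summable.mul_left
    exact (summable_PP (1 + δ / (m+1)) (by have : 0 < δ / (m+1) := by positivity
                                           linarith) (m+1)).mul_of_nonneg
      (summable_one (1 + δ) (by linarith))
      (fun q => Real.rpow_nonneg (zero_le_one.trans (one_le_PP q)) _) (fun k => by positivity)
  have hbound : ∀ pq, volume (E pq) ≤ B * ENNReal.ofReal (F pq) := by
    rintro ⟨q, p⟩
    by_cases hq : q = 0
    · have : E (q, p) = ∅ := by ext z; simp [hE, hq]
      rw [this]; simp
    obtain ⟨j, -, hj⟩ := Finset.exists_max_image (Finset.univ : Finset (Fin (m+1)))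
      (fun i => |(q i : ℝ)|) Finset.univ_nonempty
    have hqj : q j ≠ 0 := by
      intro h0
      apply hq
      ext i
      have := hj i (Finset.mem_univ _)
      simpa [h0] using this
    have hN : (1:ℝ) ≤ |(q j : ℝ)| := by exact_mod_cast Int.one_le_abs hqj
    by_cases hp : |(p:ℝ)| ≤ C * |(q j : ℝ)|
    · have h1 : volume (E (q, p)) ≤ _ := (measure_mono (fun z hz => hz.2)).trans
        (meas_bound m q j hqj (p : ℂ) R (PP q ^ (-(v / ((m+1 : ℕ) : ℝ)))))
      refine h1.trans ?_
      have h2 := real_bound m (PP q) |(q j : ℝ)| p C δ v (one_le_PP q) hN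
        (PP_le q _ hN (fun i => hj i (Finset.mem_univ _))) hC1 hp hδ hδ1 hv
      rw [hB, mul_assoc, mul_comm (NNReal.pi : ENNReal)]
      gcongr
      have hnn : 0 ≤ PP q ^ (-(v / ((m+1 : ℕ) : ℝ))) / |(q j : ℝ)| :=
        div_nonneg (Real.rpow_nonneg (zero_le_one.trans (one_le_PP q)) _) (by positivity)
      rw [← ENNReal.ofReal_pow hnn]
      exact ENNReal.ofReal_le_ofReal h2
    · have : E (q, p) = ∅ := by
        rw [Set.eq_empty_iff_forall_notMem]
        rintro z ⟨-, hz, h⟩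
        apply hp
        simp only at h
        have h3 := h.trans (hψ q)
        have h4 : ‖∑ i, z i * (q i : ℂ)‖ ≤ (m+1) * (R * |(q j : ℝ)|) := by
          calc _ ≤ ∑ i, ‖z i * (q i : ℂ)‖ := norm_sum_le _ _
            _ ≤ ∑ i : Fin (m+1), R * |(q j : ℝ)| := by
                refine Finset.sum_le_sum fun i _ => ?_
                rw [norm_mul]
                have e : ‖(q i : ℂ)‖ = |(q i : ℝ)| := by simp
                rw [e]
                exact mul_le_mul ((norm_le_pi_norm z i).trans hz) (hj i (Finset.mem_univ _))
                  (abs_nonneg _) hR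
            _ = _ := by simp
        have h5 : |(p:ℝ)| = ‖(p:ℂ)‖ := by simp
        have h6 : ‖(p:ℂ)‖ ≤ ‖(∑ i, z i * (q i : ℂ)) + (p : ℂ)‖ + ‖∑ i, z i * (q i : ℂ)‖ := by
          have := norm_sub_le ((∑ i, z i * (q i : ℂ)) + (p : ℂ)) (∑ i, z i * (q i : ℂ))
          simpa using this
        rw [h5, hC]
        nlinarith
      rw [this]; simp
  have hsum : ∑' pq, volume (E pq) ≠ ⊤ := by
    refine ne_top_of_le_ne_top ?_ (ENNReal.tsum_le_tsum hbound)
    rw [ENNReal.tsum_mul_left]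
    exact ENNReal.mul_ne_top hBt hFs.tsum_ofReal_ne_top
  filter_upwards [ae_finite_setOfPred_mem hsum] with z hz hzR
  have hfin2 : ((fun p : ℤ => ((0 : Fin (m+1) → ℤ), p)) '' (Set.Icc (-1) 1)).Finite :=
    (Set.finite_Icc _ _).image _
  refine (hz.union hfin2).subset ?_
  rintro ⟨q, p⟩ h
  by_cases hq : q = 0
  · right
    refine ⟨p, ?_, by rw [hq]⟩
    have h3 := (show _ ≤ _ from h).trans (hψ q)
    simp [hq] at h3
    have : |p| ≤ 1 := by exact_mod_cast h3
    exact abs_le.mp this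
  · left
    exact ⟨hq, hzR, h⟩

lemma upper (m : ℕ) :
    ∀ᵐ z ∂(volume : Measure (Fin (m+1) → ℂ)), ∀ v : ℝ, (m:ℝ) / 2 < v →
      {pq : (Fin (m+1) → ℤ) × ℤ | ‖(∑ i, z i * (pq.1 i : ℂ)) + (pq.2 : ℂ)‖ ≤
        (PP pq.1) ^ (-(v / ((m+1 : ℕ) : ℝ)))}.Finite := by
  have h : ∀ᵐ z ∂(volume : Measure (Fin (m+1) → ℂ)), ∀ k r : ℕ, ‖z‖ ≤ r →
      {pq : (Fin (m+1) → ℤ) × ℤ | ‖(∑ i, z i * (pq.1 i : ℂ)) + (pq.2 : ℂ)‖ ≤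
        (PP pq.1) ^ (-(((m:ℝ)/2 + 1 / ((k:ℝ)+1)) / ((m+1 : ℕ) : ℝ)))}.Finite := by
    rw [ae_all_iff]; intro k
    rw [ae_all_iff]; intro r
    refine upper_aux m (1 / ((k:ℝ)+1)) _ r (by positivity) ?_ rfl (by positivity)
    rw [div_le_one (by positivity)]
    have : (0:ℝ) ≤ k := by positivity
    linarith
  filter_upwards [h] with z hz v hv
  obtain ⟨k, hk⟩ := exists_nat_one_div_lt (sub_pos.mpr hv)
  obtain ⟨r, hr⟩ := exists_nat_ge ‖z‖
  refine (hz k r hr).subset ?_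
  rintro ⟨q, p⟩ h
  simp only [Set.mem_ofPred_eq] at h ⊢
  refine le_trans h ?_
  apply Real.rpow_le_rpow_of_exponent_le (one_le_PP q)
  apply neg_le_neg
  gcongr
  linarith

lemma pigeon (m : ℕ) (z : Fin (m+1) → ℂ) (M Q K : ℕ) (hM : ∀ i, ‖z i‖ * (m+1) ≤ M)
    (hM1 : 1 ≤ M) (hQ : 1 ≤ Q) (hK : 1 ≤ K) (hcard : 3 * M * K ^ 2 ≤ Q ^ m) :
    ∃ (q : Fin (m+1) → ℤ) (p : ℤ), q ≠ 0 ∧ (∀ i, |(q i : ℝ)| ≤ Q) ∧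
      ‖(∑ i, z i * (q i : ℂ)) + (p : ℂ)‖ ≤ 2 / K := by
  let S : (Fin (m+1) → Fin (Q+1)) → ℂ := fun a => ∑ i, z i * ((a i : ℕ) : ℂ)
  let f : (Fin (m+1) → Fin (Q+1)) → ℤ × ℤ := fun a =>
    (⌊Int.fract (S a).re * K⌋, ⌊((S a).im + M * Q) * K⌋)
  have hKr : (0:ℝ) < K := by exact_mod_cast hK
  have hSn : ∀ a, ‖S a‖ ≤ M * Q := by
    intro a
    calc ‖S a‖ ≤ ∑ i, ‖z i * ((a i : ℕ) : ℂ)‖ := norm_sum_le _ _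
      _ ≤ ∑ i : Fin (m+1), (M / (m+1) : ℝ) * Q := by
          refine Finset.sum_le_sum fun i _ => ?_
          rw [norm_mul, Complex.norm_natCast]
          have h1 : ‖z i‖ ≤ M / (m+1) := by
            rw [le_div_iff₀ (by positivity)]; exact hM i
          have h2 : ((a i : ℕ) : ℝ) ≤ Q := by exact_mod_cast Nat.lt_succ_iff.mp (a i).2
          gcongr
      _ = _ := by simp; field_simp
  let t : Finset (ℤ × ℤ) := Finset.Ico (0:ℤ) K ×ˢ Finset.Ico (0:ℤ) (2 * M * Q * K + 1)
  have hmaps : Set.MapsTo f (↑(Finset.univ : Finset (Fin (m+1) → Fin (Q+1)))) (↑t : Set (ℤ × ℤ)) := by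
    intro a _
    have him := abs_le.mp ((Complex.abs_im_le_norm (S a)).trans (hSn a))
    simp only [t, f, Finset.coe_product, Set.mem_prod, Finset.coe_Ico, Set.mem_Ico]
    refine ⟨⟨?_, ?_⟩, ?_, ?_⟩
    · exact Int.floor_nonneg.mpr (mul_nonneg (Int.fract_nonneg _) hKr.le)
    · rw [Int.floor_lt]; push_cast
      have := Int.fract_lt_one (S a).re
      nlinarith
    · exact Int.floor_nonneg.mpr (mul_nonneg (by linarith) hKr.le)
    · rw [Int.floor_lt]; push_cast
      have : ((S a).im + M * Q) * K ≤ (M * Q + M * Q) * K := by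
        apply mul_le_mul_of_nonneg_right _ hKr.le
        linarith
      linarith
  have hc : t.card < (Finset.univ : Finset (Fin (m+1) → Fin (Q+1))).card := by
    have e1 : t.card = K * (2 * M * Q * K + 1) := by
      simp only [t, Finset.card_product, Int.card_Ico]
      congr 1
    rw [e1]
    simp only [Finset.card_univ, Fintype.card_fun, Fintype.card_fin]
    have h1 : 1 ≤ M * Q * K := Nat.mul_pos (Nat.mul_pos hM1 hQ) hK
    calc K * (2 * M * Q * K + 1) ≤ K * (2 * M * Q * K + M * Q * K) := by gcongr
      _ = (3 * M * K ^ 2) * Q := by ring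
      _ ≤ Q ^ m * Q := by gcongr
      _ = Q ^ (m+1) := by ring
      _ < (Q+1) ^ (m+1) := Nat.pow_lt_pow_left (by omega) (by omega)
  obtain ⟨a, -, b, -, hab, hf⟩ := Finset.exists_ne_map_eq_of_card_lt_of_maps_to hc hmaps
  refine ⟨fun i => (a i : ℤ) - (b i : ℤ), ⌊(S b).re⌋ - ⌊(S a).re⌋, ?_, ?_, ?_⟩
  · intro h0
    apply hab
    ext i
    have := congrFun h0 i
    simp only [Pi.zero_apply] at this
    omega
  · intro i
    have h1 := (a i).2
    have h2 := (b i).2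
    have : |((a i : ℕ) : ℤ) - ((b i : ℕ) : ℤ)| ≤ Q := by
      rw [abs_le]; constructor <;> omega
    exact_mod_cast this
  · have e : (∑ i, z i * (((((a i : ℕ) : ℤ) - ((b i : ℕ) : ℤ) : ℤ)) : ℂ)) = S a - S b := by
      simp only [S, ← Finset.sum_sub_distrib]
      refine Finset.sum_congr rfl fun i _ => ?_
      push_cast; ring
    rw [e]
    simp only [f, Prod.mk.injEq] at hf
    have g1 := Int.abs_sub_lt_one_of_floor_eq_floor hf.1
    have g2 := Int.abs_sub_lt_one_of_floor_eq_floor hf.2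
    refine (Complex.norm_le_abs_re_add_abs_im _).trans ?_
    rw [le_div_iff₀ hKr, add_mul]
    nth_rewrite 1 [← abs_of_pos hKr]
    nth_rewrite 2 [← abs_of_pos hKr]
    rw [← abs_mul, ← abs_mul]
    have k1 : ((S a - S b + ((⌊(S b).re⌋ - ⌊(S a).re⌋ : ℤ) : ℂ)).re) * (K:ℝ)
        = Int.fract (S a).re * K - Int.fract (S b).re * K := by
      simp only [← Int.self_sub_floor]
      simp [-Int.self_sub_floor]; ring
    have k2 : ((S a - S b + ((⌊(S b).re⌋ - ⌊(S a).re⌋ : ℤ) : ℂ)).im) * (K:ℝ)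
        = ((S a).im + M * Q) * K - ((S b).im + M * Q) * K := by
      simp; ring
    rw [k1, k2]
    linarith

lemma lower (m : ℕ) (hm : 1 ≤ m) (z : Fin (m+1) → ℂ) (v : ℝ) (hv0 : 0 < v) (hv : v < (m:ℝ)/2) :
    {pq : (Fin (m+1) → ℤ) × ℤ | ‖(∑ i, z i * (pq.1 i : ℂ)) + (pq.2 : ℂ)‖ ≤
        (PP pq.1) ^ (-(v / ((m+1 : ℕ) : ℝ)))}.Infinite := by
  set A := {pq : (Fin (m+1) → ℤ) × ℤ | ‖(∑ i, z i * (pq.1 i : ℂ)) + (pq.2 : ℂ)‖ ≤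
        (PP pq.1) ^ (-(v / ((m+1 : ℕ) : ℝ)))} with hA
  by_cases hz : ∃ (q : Fin (m+1) → ℤ) (p : ℤ), q ≠ 0 ∧ (∑ i, z i * (q i : ℂ)) + (p : ℂ) = 0
  · obtain ⟨q, p, hq, h0⟩ := hz
    refine Set.infinite_of_injective_forall_mem (f := fun k : ℤ => (k • q, k * p)) ?_ ?_
    · intro k l hkl
      exact smul_left_injective ℤ hq (congrArg Prod.fst hkl)
    · intro k
      have : (∑ i, z i * (((k • q) i : ℤ) : ℂ)) + ((k * p : ℤ) : ℂ) = 0 := by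
        calc _ = (k:ℂ) * ((∑ i, z i * (q i : ℂ)) + (p : ℂ)) := by
              rw [mul_add, Finset.mul_sum]
              push_cast
              congr 1
              refine Finset.sum_congr rfl fun i _ => ?_
              simp; ring
          _ = 0 := by rw [h0, mul_zero]
      simp only [hA, Set.mem_ofPred_eq]
      rw [this, norm_zero]
      exact Real.rpow_nonneg (zero_le_one.trans (one_le_PP _)) _
  · intro hfin
    push Not at hz
    -- a positive lower bound for the nonzero values
    obtain ⟨ε, hε, hεA⟩ : ∃ ε > 0, ∀ pq ∈ A, pq.1 ≠ 0 →
        ε ≤ ‖(∑ i, z i * (pq.1 i : ℂ)) + (pq.2 : ℂ)‖ := by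
      let A' := {pq ∈ A | pq.1 ≠ 0}
      have hA' : A'.Finite := hfin.subset (fun x hx => hx.1)
      rcases A'.eq_empty_or_nonempty with h | h
      · exact ⟨1, one_pos, fun pq h1 h2 => absurd (show pq ∈ A' from ⟨h1, h2⟩) (by simp [h])⟩
      · obtain ⟨x, hx, hmin⟩ := Set.exists_min_image A'
          (fun pq => ‖(∑ i, z i * (pq.1 i : ℂ)) + (pq.2 : ℂ)‖) hA' h
        exact ⟨_, norm_pos_iff.mpr (hz x.1 x.2 hx.2), fun pq h1 h2 => hmin pq ⟨h1, h2⟩⟩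
    obtain ⟨M, hM⟩ := exists_nat_ge (max (‖z‖ * (m+1)) 1)
    have hM1 : 1 ≤ M := by exact_mod_cast (le_max_right _ _).trans hM
    have hMz : ∀ i, ‖z i‖ * (m+1) ≤ M := fun i =>
      (mul_le_mul_of_nonneg_right (norm_le_pi_norm z i) (by positivity)).trans
        ((le_max_left _ _).trans hM)
    have T1 : Filter.Tendsto (fun L : ℕ => (L:ℝ) ^ ((m:ℝ) - 2 * v)) Filter.atTop Filter.atTop :=
      (tendsto_rpow_atTop (by linarith)).comp tendsto_natCast_atTop_atTop
    obtain ⟨L, ⟨hL1, hL2⟩, hL3⟩ := (((T1.eventually_ge_atTop (2 * (3 * M : ℝ) ^ v)).and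
      (tendsto_natCast_atTop_atTop.eventually_gt_atTop (2 / ε))).and
      (Filter.eventually_ge_atTop 1)).exists
    have hLr : (1:ℝ) ≤ L := by exact_mod_cast hL3
    have hL0 : (0:ℝ) < L := by linarith
    have hMr : (1:ℝ) ≤ M := by exact_mod_cast hM1
    obtain ⟨q, p, hq, hqQ, hqp⟩ := pigeon m z M (3 * M * L ^ 2) (L ^ m) hMz hM1
      (Nat.mul_pos (by omega) (Nat.pow_pos hL3)) (Nat.pow_pos hL3) (by
        rw [mul_pow (3 * M), ← pow_mul, ← pow_mul, mul_comm 2 m]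
        gcongr
        exact Nat.le_self_pow (by omega) _)
    have hmem : (q, p) ∈ A := by
      refine le_trans hqp ?_
      push_cast at hqQ ⊢
      have hQ1 : (1:ℝ) ≤ 3 * M * L ^ 2 := by
        have : (1:ℝ) ≤ (L:ℝ)^2 := one_le_pow₀ hLr
        nlinarith
      have h1 := PP_le q _ hQ1 hqQ
      have hP0 : 0 < PP q := lt_of_lt_of_le one_pos (one_le_PP q)
      have h2 : ((3 * M * L ^ 2 : ℝ) ^ (m+1)) ^ (-(v / ((m:ℝ)+1))) ≤ PP q ^ (-(v / ((m:ℝ)+1))) := by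
        apply Real.rpow_le_rpow_of_nonpos hP0 h1
        have : 0 ≤ v / ((m:ℝ)+1) := by positivity
        linarith
      refine le_trans ?_ h2
      have e1 : ((3 * M * L ^ 2 : ℝ) ^ (m+1)) ^ (-(v / ((m:ℝ)+1))) =
          ((3 * M : ℝ) ^ v * (L:ℝ) ^ (2 * v))⁻¹ := by
        rw [← Real.rpow_natCast _ (m+1), ← Real.rpow_mul (by positivity)]
        have : ((m+1 : ℕ) : ℝ) * (-(v / ((m:ℝ)+1))) = -v := by push_cast; field_simp
        rw [this, Real.rpow_neg (by positivity), Real.mul_rpow (by positivity) (by positivity),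
          Real.rpow_mul hL0.le]
        norm_num
      rw [e1]
      rw [Real.rpow_sub hL0, Real.rpow_natCast, le_div_iff₀ (by positivity)] at hL1
      rw [div_le_iff₀ (by positivity), inv_mul_eq_div, le_div_iff₀ (by positivity)]
      linarith
    have h1 := hεA _ hmem hq
    have h2 : (2:ℝ) / ((L ^ m : ℕ) : ℝ) < ε := by
      rw [div_lt_iff₀ (by positivity)]
      rw [div_lt_iff₀ hε] at hL2
      have : (L:ℝ) ≤ (L:ℝ)^m := le_self_pow₀ hLr (by omega)
      push_cast
      nlinarith
    exact absurd (h1.trans hqp) (not_le.mpr h2)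

theorem omegaMul_ae_eq (n : ℕ) (hn : 1 ≤ n) :
    ∀ᵐ z ∂(volume : Measure (Fin n → ℂ)),
      omegaMul n z = ENNReal.ofReal (((n : ℝ) - 1) / 2) := by
  obtain ⟨m, rfl⟩ : ∃ m, n = m + 1 := ⟨n - 1, by omega⟩
  have e : (((m + 1 : ℕ) : ℝ) - 1) / 2 = (m:ℝ) / 2 := by push_cast; ring
  rw [e]
  filter_upwards [upper m] with z hz
  apply le_antisymm
  · apply sSup_le
    rintro _ ⟨v, ⟨hv0, hinf⟩, rfl⟩
    apply ENNReal.ofReal_le_ofReal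
    by_contra hlt
    exact hinf (hz v (not_le.mp hlt))
  · rcases Nat.eq_zero_or_pos m with rfl | hm
    · simp
    · refine le_of_forall_lt fun c hc => ?_
      have hct : c ≠ ⊤ := ne_top_of_lt hc
      have hc' : c.toReal < (m:ℝ)/2 := (ENNReal.lt_ofReal_iff_toReal_lt hct).mp hc
      obtain ⟨v, hv1, hv2⟩ := exists_between hc'
      have hv0 : 0 < v := lt_of_le_of_lt ENNReal.toReal_nonneg hv1
      refine lt_of_lt_of_le ((ENNReal.lt_ofReal_iff_toReal_lt hct).mpr hv1) ?_
      exact le_sSup ⟨v, ⟨hv0, lower m hm z v hv0 hv2⟩, rfl⟩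
end
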